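/- arXiv:math/0307221 — 2 statements merged into one kernel-verified Lean document; each statement's English description precedes it below -/
import Mathlib

section
/- For every fixed ε > 0, the Riemann zeta function satisfies ζ(σ + it) ≪_ε 1 + |t|^{(1-σ)/3 + ε}, uniformly for σ ≥ 1/2 and |t| ≥ 1. -/
open Complex Filter Asymptotics
open scoped ComplexConjugate

/-- The additive character `x ↦ exp (2πix)`. -/
noncomputable def expPhase (x : ℝ) : ℂ := cexp ((2 * Real.pi * x : ℝ) * I)

lemma norm_expPhase (x : ℝ) : ‖expPhase x‖ = 1 := norm_exp_ofReal_mul_I _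

lemma expPhase_add (x y : ℝ) : expPhase (x + y) = expPhase x * expPhase y := by
  rw [expPhase, expPhase, expPhase, ← Complex.exp_add]
  push_cast
  ring_nf

lemma expPhase_intCast (k : ℤ) : expPhase k = 1 := by
  rw [expPhase, Complex.exp_eq_one_iff]
  exact ⟨k, by push_cast; ring⟩

lemma conj_expPhase (x : ℝ) : conj (expPhase x) = expPhase (-x) := by
  rw [expPhase, expPhase, ← Complex.exp_conj, map_mul, conj_I, conj_ofReal]
  push_cast
  ring_nf

lemma two_mul_le_sin_pi_mul {θ x : ℝ} (hθ : 0 ≤ θ) (h₁ : θ ≤ x) (h₂ : x ≤ 1 - θ) :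
    2 * θ ≤ Real.sin (Real.pi * x) := by
  have hpi := Real.pi_pos
  have key : ∀ y, θ ≤ y → y ≤ 1 / 2 → 2 * θ ≤ Real.sin (Real.pi * y) := fun y hy hy' ↦ by
    have := Real.mul_le_sin (x := Real.pi * y) (by nlinarith) (by nlinarith)
    have h : 2 / Real.pi * (Real.pi * y) = 2 * y := by field_simp
    linarith
  rcases le_total x (1 / 2) with h | h
  · exact key x h₁ h
  · have := key (1 - x) (by linarith) (by linarith)
    rwa [mul_sub, mul_one, Real.sin_pi_sub] at this

/-- The coefficient `1 / (exp (2πix) - 1)` in terms of the cotangent. -/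
noncomputable def cotCoeff (x : ℝ) : ℂ :=
  -(1 / 2) - (Real.cos (Real.pi * x) / Real.sin (Real.pi * x) / 2 : ℝ) * I

lemma cotCoeff_mul_expPhase_sub_one {x : ℝ} (hx : Real.sin (Real.pi * x) ≠ 0) :
    cotCoeff x * (expPhase x - 1) = 1 := by
  have h : expPhase x = (Real.cos (Real.pi * x) + Real.sin (Real.pi * x) * I) ^ 2 := by
    rw [expPhase, ofReal_cos, ofReal_sin, ← Complex.exp_mul_I, ← Complex.exp_nat_mul]
    push_cast
    ring_nf
  have hs : (Real.sin (Real.pi * x) : ℂ) ≠ 0 := ofReal_ne_zero.mpr hx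
  have hsc : (Real.sin (Real.pi * x) : ℂ) ^ 2 + (Real.cos (Real.pi * x) : ℂ) ^ 2 = 1 := by
    exact_mod_cast Real.sin_sq_add_cos_sq _
  rw [h, cotCoeff, ofReal_div, ofReal_div, ofReal_ofNat]
  generalize (Real.sin (Real.pi * x) : ℂ) = s at *
  generalize (Real.cos (Real.pi * x) : ℂ) = c at *
  have hI : I ^ 2 = -1 := I_sq
  have h2 : (c + s * I) ^ 2 - 1 = 2 * s * I * (c + s * I) := by
    linear_combination hsc - s ^ 2 * hI
  rw [h2]
  field_simp
  linear_combination (-c * s * I - c ^ 2 - s ^ 2) * hI + hsc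

lemma norm_cotCoeff_le {θ x : ℝ} (hθ : 0 < θ) (h₁ : θ ≤ x) (h₂ : x ≤ 1 - θ) :
    ‖cotCoeff x‖ ≤ 1 / (4 * θ) := by
  have hs := two_mul_le_sin_pi_mul hθ.le h₁ h₂
  have hs0 : 0 < Real.sin (Real.pi * x) := by linarith
  have : ‖cotCoeff x‖ = 1 / (2 * Real.sin (Real.pi * x)) := by
    rw [← sq_eq_sq₀ (norm_nonneg _) (by positivity), ← normSq_eq_norm_sq, normSq_apply, cotCoeff]
    have := Real.sin_sq_add_cos_sq (Real.pi * x)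
    simp only [sub_re, neg_re, sub_im, neg_im, re_ofReal_mul, im_ofReal_mul, I_re, I_im]
    norm_num
    field_simp
    linarith
  rw [this]
  exact one_div_le_one_div_of_le (by positivity) (by linarith)

lemma norm_cotCoeff_sub {x y : ℝ} (hx : 0 < x) (hxy : x ≤ y) (hy : y < 1) :
    ‖cotCoeff y - cotCoeff x‖ = (cotCoeff y).im - (cotCoeff x).im := by
  have hpi := Real.pi_pos
  have h1 : 0 < Real.sin (Real.pi * x) :=
    Real.sin_pos_of_pos_of_lt_pi (by positivity) (by nlinarith)
  have h2 : 0 < Real.sin (Real.pi * y) :=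
    Real.sin_pos_of_pos_of_lt_pi (by nlinarith) (by nlinarith)
  have h3 : 0 ≤ Real.sin (Real.pi * y - Real.pi * x) :=
    Real.sin_nonneg_of_nonneg_of_le_pi (by nlinarith) (by nlinarith)
  rw [Real.sin_sub] at h3
  have h4 : Real.cos (Real.pi * y) / Real.sin (Real.pi * y) / 2 ≤
      Real.cos (Real.pi * x) / Real.sin (Real.pi * x) / 2 := by
    gcongr ?_ / 2
    rw [div_le_div_iff₀ h2 h1]
    linarith
  have h5 : cotCoeff y - cotCoeff x = ((Real.cos (Real.pi * x) / Real.sin (Real.pi * x) / 2 -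
      Real.cos (Real.pi * y) / Real.sin (Real.pi * y) / 2 : ℝ) : ℂ) * I := by
    rw [cotCoeff, cotCoeff]
    push_cast
    ring
  rw [← sub_im, h5, norm_mul, norm_I, mul_one, norm_real, Real.norm_of_nonneg (by linarith),
    im_ofReal_mul, I_im, mul_one]

/-- The **Kusmin–Landau inequality**, for sequences with monotone increments. -/
lemma norm_sum_expPhase_le_of_increments {f : ℕ → ℝ} {a b : ℕ} {k : ℤ} {θ : ℝ} (hθ : 0 < θ)
    (h₁ : ∀ n, a ≤ n → n < b → k + θ ≤ f (n + 1) - f n)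
    (h₂ : ∀ n, a ≤ n → n < b → f (n + 1) - f n ≤ k + 1 - θ)
    (hmono : ∀ n, a ≤ n → n + 1 < b → f (n + 1) - f n ≤ f (n + 2) - f (n + 1)) :
    ‖∑ n ∈ Finset.Ico a b, expPhase (f n)‖ ≤ 1 / θ := by
  rcases le_or_gt b a with hab | hab
  · simp [Finset.Ico_eq_empty_of_le hab, hθ.le]
  obtain ⟨d, rfl⟩ := Nat.exists_eq_add_of_lt hab
  set x : ℕ → ℝ := fun n ↦ f (n + 1) - f n - k with hx
  have hx1 : ∀ n, a ≤ n → n < a + d + 1 → θ ≤ x n := fun n hn hn' ↦ by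
    have := h₁ n hn hn'
    simp only [hx]
    linarith
  have hx2 : ∀ n, a ≤ n → n < a + d + 1 → x n ≤ 1 - θ := fun n hn hn' ↦ by
    have := h₂ n hn hn'
    simp only [hx]
    linarith
  have hterm : ∀ n, a ≤ n → n < a + d + 1 →
      expPhase (f n) = cotCoeff (x n) * (expPhase (f (n + 1)) - expPhase (f n)) := by
    intro n hn hn'
    have hs := two_mul_le_sin_pi_mul hθ.le (hx1 n hn hn') (hx2 n hn hn')
    have h1 := cotCoeff_mul_expPhase_sub_one (x := x n) (by linarith)
    have h2 : expPhase (f (n + 1)) = expPhase (f n) * expPhase (x n) := by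
      have : f (n + 1) = f n + x n + k := by simp only [hx]; ring
      rw [this, expPhase_add, expPhase_add, expPhase_intCast, mul_one]
    rw [h2]
    linear_combination (-expPhase (f n)) * h1
  have key : ∀ j ≤ d, ‖∑ n ∈ Finset.Ico a (a + j + 1), expPhase (f n) -
      (cotCoeff (x (a + j)) * expPhase (f (a + j + 1)) - cotCoeff (x a) * expPhase (f a))‖ ≤
      (cotCoeff (x (a + j))).im - (cotCoeff (x a)).im := by
    intro j
    induction j with
    | zero =>
      intro _
      rw [add_zero, Finset.sum_Ico_succ_top le_rfl, Finset.Ico_self, Finset.sum_empty, zero_add]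
      nth_rewrite 1 [hterm a le_rfl (by lia)]
      rw [← mul_sub, sub_self, sub_self, norm_zero]
    | succ j ih =>
      intro hj
      have ih := ih (by lia)
      have hm : x (a + j) ≤ x (a + j + 1) := by
        have := hmono (a + j) (by lia) (by lia)
        simp only [hx]
        linarith
      have hvar := norm_cotCoeff_sub (hθ.trans_le (hx1 (a + j) (by lia) (by lia))) hm
        (by linarith [hx2 (a + j + 1) (by lia) (by lia)])
      have ht := hterm (a + j + 1) (by lia) (by lia)
      have : a + (j + 1) = a + j + 1 := by ring
      rw [this, Finset.sum_Ico_succ_top (by lia)]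
      have heq : ∑ n ∈ Finset.Ico a (a + j + 1), expPhase (f n) + expPhase (f (a + j + 1)) -
          (cotCoeff (x (a + j + 1)) * expPhase (f (a + j + 1 + 1)) -
            cotCoeff (x a) * expPhase (f a)) =
          (∑ n ∈ Finset.Ico a (a + j + 1), expPhase (f n) -
          (cotCoeff (x (a + j)) * expPhase (f (a + j + 1)) - cotCoeff (x a) * expPhase (f a))) -
          (cotCoeff (x (a + j + 1)) - cotCoeff (x (a + j))) * expPhase (f (a + j + 1)) := by
        linear_combination ht
      rw [heq]
      refine (norm_sub_le _ _).trans ?_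
      rw [norm_mul, norm_expPhase, mul_one, hvar]
      linarith
  have hfin := key d le_rfl
  have hb := norm_cotCoeff_le hθ (hx1 (a + d) (by lia) (by lia)) (hx2 (a + d) (by lia) (by lia))
  have ha := norm_cotCoeff_le hθ (hx1 a le_rfl (by lia)) (hx2 a le_rfl (by lia))
  have hib := (abs_le.mp ((abs_im_le_norm _).trans hb)).2
  have hia := (abs_le.mp ((abs_im_le_norm _).trans ha)).1
  have hsub := norm_sub_le (cotCoeff (x (a + d)) * expPhase (f (a + d + 1)))
    (cotCoeff (x a) * expPhase (f a))
  rw [norm_mul, norm_mul, norm_expPhase, norm_expPhase, mul_one, mul_one] at hsub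
  have htri := norm_le_norm_sub_add (∑ n ∈ Finset.Ico a (a + d + 1), expPhase (f n))
    (cotCoeff (x (a + d)) * expPhase (f (a + d + 1)) - cotCoeff (x a) * expPhase (f a))
  have : 1 / θ = 4 * (1 / (4 * θ)) := by field_simp
  linarith

lemma exists_eq_Ico_of_convex (S : Finset ℕ)
    (h : ∀ x ∈ S, ∀ z ∈ S, ∀ y, x ≤ y → y ≤ z → y ∈ S) : ∃ p q, S = Finset.Ico p q := by
  rcases S.eq_empty_or_nonempty with rfl | hS
  · exact ⟨0, 0, by simp⟩
  · refine ⟨S.min' hS, S.max' hS + 1, ?_⟩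
    ext y
    rw [Finset.mem_Ico, Nat.lt_succ_iff]
    exact ⟨fun hy ↦ ⟨S.min'_le y hy, S.le_max' y hy⟩,
      fun hy ↦ h _ (S.min'_mem hS) _ (S.max'_mem hS) y hy.1 hy.2⟩

section IncrementGaps

variable {δ : ℕ → ℝ} {a b : ℕ} {lam : ℝ}

lemma mul_sub_le_of_gap_ge (h : ∀ n, a ≤ n → n + 1 < b → lam ≤ δ (n + 1) - δ n) {m n : ℕ}
    (hm : a ≤ m) (hmn : m ≤ n) (hn : n < b) : ((n : ℝ) - m) * lam ≤ δ n - δ m := by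
  induction n, hmn using Nat.le_induction with
  | base => simp
  | succ n hmn ih =>
    have h1 := ih (by lia)
    have h2 := h n (by lia) hn
    push_cast
    linarith

lemma le_mul_sub_of_gap_le (h : ∀ n, a ≤ n → n + 1 < b → δ (n + 1) - δ n ≤ lam) {m n : ℕ}
    (hm : a ≤ m) (hmn : m ≤ n) (hn : n < b) : δ n - δ m ≤ ((n : ℝ) - m) * lam := by
  induction n, hmn using Nat.le_induction with
  | base => simp
  | succ n hmn ih =>
    have h1 := ih (by lia)
    have h2 := h n (by lia) hn
    push_cast
    linarith

lemma card_le_of_gap_ge (hlam : 0 < lam) (h : ∀ n, a ≤ n → n + 1 < b → lam ≤ δ (n + 1) - δ n)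
    {S : Finset ℕ} (hS : S ⊆ Finset.Ico a b) {θ : ℝ} (hθ : 0 ≤ θ)
    (hδ : ∀ x ∈ S, ∀ y ∈ S, δ y - δ x ≤ θ) : (S.card : ℝ) ≤ θ / lam + 1 := by
  rcases S.eq_empty_or_nonempty with rfl | hne
  · simp only [Finset.card_empty, Nat.cast_zero]
    positivity
  have hmin := S.min'_mem hne
  have hmax := S.max'_mem hne
  have hle : S.min' hne ≤ S.max' hne := S.min'_le _ hmax
  have hsub : S ⊆ Finset.Icc (S.min' hne) (S.max' hne) := fun y hy ↦
    Finset.mem_Icc.mpr ⟨S.min'_le y hy, S.le_max' y hy⟩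
  have hcard := Finset.card_le_card hsub
  rw [Nat.card_Icc] at hcard
  have hcard' : (S.card : ℝ) ≤ (S.max' hne : ℝ) - S.min' hne + 1 := by
    have : S.card + S.min' hne ≤ S.max' hne + 1 := by lia
    have : (S.card : ℝ) + S.min' hne ≤ S.max' hne + 1 := by exact_mod_cast this
    linarith
  have hgap := mul_sub_le_of_gap_ge h (Finset.mem_Ico.mp (hS hmin)).1 hle
    (Finset.mem_Ico.mp (hS hmax)).2
  have hup := hδ _ hmin _ hmax
  have : (S.max' hne : ℝ) - S.min' hne ≤ θ / lam := by
    rw [le_div_iff₀ hlam]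
    linarith
  linarith

end IncrementGaps

lemma norm_sum_expPhase_le_card (f : ℕ → ℝ) (S : Finset ℕ) :
    ‖∑ n ∈ S, expPhase (f n)‖ ≤ S.card :=
  (norm_sum_le _ _).trans (by simp [norm_expPhase])

/-- The contribution to van der Corput's estimate of the increments with a given integer part. -/
lemma norm_sum_expPhase_floor_le {f : ℕ → ℝ} {a b : ℕ} {lam : ℝ} (hlam : 0 < lam)
    (hlam1 : lam ≤ 1)
    (h : ∀ n, a ≤ n → n + 1 < b → lam ≤ f (n + 2) - f (n + 1) - (f (n + 1) - f n)) (k : ℤ) :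
    ‖∑ n ∈ Finset.Ico a b with ⌊f (n + 1) - f n⌋ = k, expPhase (f n)‖ ≤ 5 / √lam := by
  set δ : ℕ → ℝ := fun n ↦ f (n + 1) - f n with hδ
  have hgap : ∀ n, a ≤ n → n + 1 < b → lam ≤ δ (n + 1) - δ n := h
  have hmono : ∀ m n, a ≤ m → m ≤ n → n < b → δ m ≤ δ n := fun m n hm hmn hn ↦ by
    have h1 := mul_sub_le_of_gap_ge hgap hm hmn hn
    have h2 : (m : ℝ) ≤ n := by exact_mod_cast hmn
    nlinarith
  have hsq : 0 < √lam := Real.sqrt_pos.mpr hlam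
  have hsq2 : √lam ^ 2 = lam := Real.sq_sqrt hlam.le
  set θ := √lam / 2 with hθ
  have hθ0 : 0 < θ := by positivity
  set S := {n ∈ Finset.Ico a b | ⌊f (n + 1) - f n⌋ = k} with hS
  have hmem : ∀ n ∈ S, a ≤ n ∧ n < b ∧ k ≤ δ n ∧ δ n < k + 1 := fun n hn ↦ by
    rw [hS, Finset.mem_filter, Finset.mem_Ico, Int.floor_eq_iff] at hn
    exact ⟨hn.1.1, hn.1.2, hn.2.1, hn.2.2⟩
  have hmem' : ∀ n, a ≤ n → n < b → k ≤ δ n → δ n < k + 1 → n ∈ S := fun n h1 h2 h3 h4 ↦ by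
    rw [hS, Finset.mem_filter, Finset.mem_Ico, Int.floor_eq_iff]
    exact ⟨⟨h1, h2⟩, h3, h4⟩
  have hSsub : S ⊆ Finset.Ico a b := Finset.filter_subset _ _
  have hA : (({n ∈ S | δ n < k + θ}).card : ℝ) ≤ θ / lam + 1 := by
    refine card_le_of_gap_ge hlam hgap ((Finset.filter_subset _ _).trans hSsub) hθ0.le ?_
    intro x hx y hy
    rw [Finset.mem_filter] at hx hy
    linarith [(hmem x hx.1).2.2.1]
  set T := {n ∈ S | ¬ δ n < k + θ} with hT
  have hB : (({n ∈ T | k + 1 - θ < δ n}).card : ℝ) ≤ θ / lam + 1 := by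
    refine card_le_of_gap_ge hlam hgap (((Finset.filter_subset _ _).trans
      (Finset.filter_subset _ _)).trans hSsub) hθ0.le ?_
    intro x hx y hy
    rw [Finset.mem_filter, Finset.mem_filter] at hx hy
    linarith [(hmem y hy.1.1).2.2.2]
  have hC : ‖∑ n ∈ T with ¬ k + 1 - θ < δ n, expPhase (f n)‖ ≤ 1 / θ := by
    have hmemT : ∀ n, n ∈ T.filter (fun n ↦ ¬ k + 1 - θ < δ n) ↔
        a ≤ n ∧ n < b ∧ k + θ ≤ δ n ∧ δ n ≤ k + 1 - θ := by
      intro n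
      rw [Finset.mem_filter, hT, Finset.mem_filter, not_lt, not_lt]
      constructor
      · rintro ⟨⟨h1, h2⟩, h3⟩
        exact ⟨(hmem n h1).1, (hmem n h1).2.1, h2, h3⟩
      · rintro ⟨h1, h2, h3, h4⟩
        exact ⟨⟨hmem' n h1 h2 (by linarith) (by linarith), h3⟩, h4⟩
    obtain ⟨p, q, hpq⟩ := exists_eq_Ico_of_convex (T.filter (fun n ↦ ¬ k + 1 - θ < δ n)) (by
      intro x hx z hz y hxy hyz
      rw [hmemT] at hx hz ⊢
      have h1 := hmono x y hx.1 hxy (by lia)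
      have h2 := hmono y z (by lia) hyz hz.2.1
      exact ⟨by lia, by lia, by linarith [hx.2.2.1], by linarith [hz.2.2.2]⟩)
    rw [hpq] at hmemT ⊢
    simp only [Finset.mem_Ico] at hmemT
    refine norm_sum_expPhase_le_of_increments (k := k) hθ0 (fun n h1 h2 ↦ ?_) (fun n h1 h2 ↦ ?_)
      (fun n h1 h2 ↦ ?_)
    · exact ((hmemT n).mp ⟨h1, h2⟩).2.2.1
    · exact ((hmemT n).mp ⟨h1, h2⟩).2.2.2
    · exact hmono n (n + 1) ((hmemT n).mp ⟨h1, by lia⟩).1 (by lia)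
        ((hmemT (n + 1)).mp ⟨by lia, h2⟩).2.1
  rw [← Finset.sum_filter_add_sum_filter_not S (fun n ↦ δ n < k + θ),
    ← Finset.sum_filter_add_sum_filter_not T (fun n ↦ k + 1 - θ < δ n)]
  refine (norm_add_le _ _).trans ((add_le_add ((norm_sum_expPhase_le_card _ _).trans hA)
    ((norm_add_le _ _).trans (add_le_add ((norm_sum_expPhase_le_card _ _).trans hB) hC))).trans ?_)
  have h1 : √lam ≤ 1 := Real.sqrt_le_one.mpr hlam1
  have h2 : θ / lam = 1 / (2 * √lam) := by
    rw [hθ, ← hsq2]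
    simp only [Real.sqrt_sq hsq.le]
    field_simp
  have h3 : 1 / θ = 2 / √lam := by
    rw [hθ]
    field_simp
  have h4 : 1 ≤ 1 / √lam := by
    rw [le_div_iff₀ hsq]
    linarith
  have h5 : 1 / (2 * √lam) = (1 / √lam) / 2 := by field_simp
  have h6 : 2 / √lam = 2 * (1 / √lam) := by field_simp
  have h7 : 5 / √lam = 5 * (1 / √lam) := by field_simp
  rw [h2, h3, h5, h6, h7]
  linarith

/-- **Van der Corput's second derivative estimate**, in terms of second differences. -/
lemma norm_sum_expPhase_le_of_second_difference {f : ℕ → ℝ} {a b : ℕ} {lam c : ℝ}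
    (hab : a ≤ b) (hlam : 0 < lam) (hlam1 : lam ≤ 1) (hc : 0 ≤ c)
    (h₁ : ∀ n, a ≤ n → n + 1 < b → lam ≤ f (n + 2) - f (n + 1) - (f (n + 1) - f n))
    (h₂ : ∀ n, a ≤ n → n + 1 < b → f (n + 2) - f (n + 1) - (f (n + 1) - f n) ≤ c * lam) :
    ‖∑ n ∈ Finset.Ico a b, expPhase (f n)‖ ≤ (((b : ℝ) - a) * (c * lam) + 2) * (5 / √lam) := by
  have hab' : (a : ℝ) ≤ b := by exact_mod_cast hab
  rcases hab.eq_or_lt with rfl | hlt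
  · simp only [Finset.Ico_self, Finset.sum_empty, norm_zero]
    positivity
  set δ : ℕ → ℝ := fun n ↦ f (n + 1) - f n with hδ
  have hgap : ∀ n, a ≤ n → n + 1 < b → lam ≤ δ (n + 1) - δ n := h₁
  have hgap' : ∀ n, a ≤ n → n + 1 < b → δ (n + 1) - δ n ≤ c * lam := h₂
  have hmono : ∀ m n, a ≤ m → m ≤ n → n < b → δ m ≤ δ n := fun m n hm hmn hn ↦ by
    have h1 := mul_sub_le_of_gap_ge hgap hm hmn hn
    have h2 : (m : ℝ) ≤ n := by exact_mod_cast hmn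
    nlinarith
  have hmaps : ∀ n ∈ Finset.Ico a b, ⌊δ n⌋ ∈ Finset.Icc ⌊δ a⌋ ⌊δ (b - 1)⌋ := fun n hn ↦ by
    rw [Finset.mem_Ico] at hn
    rw [Finset.mem_Icc]
    exact ⟨Int.floor_le_floor (hmono a n le_rfl hn.1 hn.2),
      Int.floor_le_floor (hmono n (b - 1) hn.1 (by lia) (by lia))⟩
  rw [← Finset.sum_fiberwise_of_maps_to hmaps]
  refine (norm_sum_le _ _).trans
    ((Finset.sum_le_sum fun k _ ↦ norm_sum_expPhase_floor_le hlam hlam1 h₁ k).trans ?_)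
  rw [Finset.sum_const, nsmul_eq_mul]
  gcongr
  have htot := le_mul_sub_of_gap_le hgap' le_rfl (show a ≤ b - 1 by lia) (by lia)
  have hle : ⌊δ a⌋ ≤ ⌊δ (b - 1)⌋ := Int.floor_le_floor (hmono a (b - 1) le_rfl (by lia) (by lia))
  have hcard : ((Finset.Icc ⌊δ a⌋ ⌊δ (b - 1)⌋).card : ℝ) = ⌊δ (b - 1)⌋ + 1 - ⌊δ a⌋ := by
    have := Int.card_Icc_of_le ⌊δ a⌋ ⌊δ (b - 1)⌋ (by lia)
    exact_mod_cast this
  rw [hcard]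
  have h1 := Int.floor_le (δ (b - 1))
  have h2 := Int.lt_floor_add_one (δ a)
  rw [Nat.cast_sub (by lia)] at htot
  push_cast at htot
  have : 0 ≤ c * lam := by positivity
  nlinarith

lemma sum_Ico_shift_eq {v : ℕ → ℂ} {N H h : ℕ} (hh : h ≤ H)
    (hv : ∀ m, m < H ∨ N + H ≤ m → v m = 0) :
    ∑ m ∈ Finset.range (N + H), v (m + h) = ∑ m ∈ Finset.Ico H (N + H), v m := by
  rw [Finset.range_eq_Ico, Finset.sum_Ico_add' v 0 (N + H) h, zero_add]
  symm
  refine Finset.sum_subset (Finset.Ico_subset_Ico hh (by lia)) fun m _ hm ↦ hv m ?_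
  rw [Finset.mem_Ico] at hm
  lia

lemma sum_range_dist_le {H h : ℕ} (hh : h < H) {D : ℕ → ℝ} (hD : ∀ r, 0 ≤ D r) :
    ∑ h' ∈ Finset.range H, D ((h' - h) + (h - h')) ≤ 2 * ∑ r ∈ Finset.range H, D r := by
  rw [Finset.range_eq_Ico, ← Finset.sum_Ico_consecutive _ (Nat.zero_le h) hh.le, two_mul]
  refine add_le_add ?_ ?_
  · have h1 : ∑ h' ∈ Finset.Ico 0 h, D ((h' - h) + (h - h')) =
        ∑ h' ∈ Finset.Ico 0 h, D (h - h') :=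
      Finset.sum_congr rfl fun x hx ↦ by
        rw [Finset.mem_Ico] at hx
        congr 1
        lia
    rw [h1, Finset.sum_Ico_reflect D 0 (show h ≤ h + 1 by lia)]
    exact Finset.sum_le_sum_of_subset_of_nonneg
      (fun x hx ↦ by rw [Finset.mem_Ico] at hx ⊢; lia) fun r _ _ ↦ hD r
  · have h1 : ∑ h' ∈ Finset.Ico h H, D ((h' - h) + (h - h')) =
        ∑ r ∈ Finset.range (H - h), D r := by
      rw [Finset.sum_Ico_eq_sum_range]
      exact Finset.sum_congr rfl fun x _ ↦ by congr 1; lia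
    rw [h1]
    exact Finset.sum_le_sum_of_subset_of_nonneg
      (fun x hx ↦ by rw [Finset.mem_range] at hx; rw [Finset.mem_Ico]; lia) fun r _ _ ↦ hD r

/-- The correlations of a finitely supported sequence are controlled by their lag. -/
lemma norm_sum_shift_mul_conj_le {v : ℕ → ℂ} {N H h h' : ℕ} (hh : h < H) (hh' : h' < H)
    (hv : ∀ m, m < H ∨ N + H ≤ m → v m = 0) :
    ‖∑ m ∈ Finset.range (N + H), v (m + h) * conj (v (m + h'))‖ =
      ‖∑ m ∈ Finset.Ico H (N + H), v m * conj (v (m + ((h' - h) + (h - h'))))‖ := by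
  have key : ∀ p q, p < H → p ≤ q →
      ∑ m ∈ Finset.range (N + H), v (m + p) * conj (v (m + q)) =
        ∑ m ∈ Finset.Ico H (N + H), v m * conj (v (m + (q - p))) := by
    intro p q hp hpq
    have := sum_Ico_shift_eq (v := fun m ↦ v m * conj (v (m + (q - p)))) (N := N) hp.le
      (fun m hm ↦ by simp [hv m hm])
    rw [← this]
    refine Finset.sum_congr rfl fun m _ ↦ ?_
    rw [show m + p + (q - p) = m + q by lia]
  rcases le_total h h' with hle | hle
  · rw [key h h' hh hle, show h' - h + (h - h') = h' - h by lia]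
  · rw [show h' - h + (h - h') = h - h' by lia, ← key h' h hh' hle, ← norm_conj, map_sum]
    congr 1
    refine Finset.sum_congr rfl fun m _ ↦ ?_
    rw [map_mul, conj_conj, mul_comm]

/-- The **Weyl–van der Corput inequality**. -/
lemma mul_sq_norm_sum_le_sum_correlation (z : ℕ → ℂ) {a b : ℕ} (hab : a ≤ b) {H : ℕ}
    (hH : 0 < H) :
    (H : ℝ) * ‖∑ n ∈ Finset.Ico a b, z n‖ ^ 2 ≤ 2 * ((b : ℝ) - a + H) *
      ∑ r ∈ Finset.range H, ‖∑ n ∈ Finset.Ico a (b - r), z n * conj (z (n + r))‖ := by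
  obtain ⟨N, rfl⟩ := Nat.exists_eq_add_of_le hab
  set v : ℕ → ℂ := fun m ↦ if H ≤ m ∧ m < N + H then z (a + m - H) else 0 with hvdef
  have hv : ∀ m, m < H ∨ N + H ≤ m → v m = 0 := fun m hm ↦ by
    simp only [hvdef]
    rw [if_neg (by lia)]
  set D : ℕ → ℝ := fun r ↦ ‖∑ n ∈ Finset.Ico a (a + N - r), z n * conj (z (n + r))‖ with hD
  have hvS : ∑ m ∈ Finset.Ico H (N + H), v m = ∑ n ∈ Finset.Ico a (a + N), z n := by
    rw [Finset.sum_Ico_eq_sum_range, Finset.sum_Ico_eq_sum_range]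
    refine Finset.sum_congr (by congr 1; lia) fun m hm ↦ ?_
    rw [Finset.mem_range] at hm
    simp only [hvdef]
    rw [if_pos (by lia)]
    congr 1
    lia
  have hvD : ∀ r, ‖∑ m ∈ Finset.Ico H (N + H), v m * conj (v (m + r))‖ = D r := by
    intro r
    simp only [hD]
    rw [Finset.sum_Ico_eq_sum_range, Finset.sum_Ico_eq_sum_range]
    congr 1
    symm
    have : ∀ m ∈ Finset.range (a + N - r - a),
        z (a + m) * conj (z (a + m + r)) = v (H + m) * conj (v (H + m + r)) := by
      intro m hm
      rw [Finset.mem_range] at hm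
      simp only [hvdef]
      rw [if_pos (by lia), if_pos (by lia)]
      congr 3 <;> lia
    rw [Finset.sum_congr rfl this]
    refine Finset.sum_subset (fun x hx ↦ by rw [Finset.mem_range] at hx ⊢; lia) fun m hm hm' ↦ ?_
    rw [Finset.mem_range] at hm hm'
    rw [hv (H + m + r) (by lia), map_zero, mul_zero]
  have hHS : (H : ℂ) * ∑ n ∈ Finset.Ico a (a + N), z n =
      ∑ m ∈ Finset.range (N + H), ∑ h ∈ Finset.range H, v (m + h) := by
    rw [Finset.sum_comm, ← hvS, ← nsmul_eq_mul, ← Finset.card_range H, ← Finset.sum_const,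
      Finset.card_range]
    exact Finset.sum_congr rfl fun h hh ↦
      (sum_Ico_shift_eq (Finset.mem_range.mp hh).le hv).symm
  have hsq : ∑ m ∈ Finset.range (N + H), ‖∑ h ∈ Finset.range H, v (m + h)‖ ^ 2 ≤
      H * (2 * ∑ r ∈ Finset.range H, D r) := by
    have h1 : ((∑ m ∈ Finset.range (N + H), ‖∑ h ∈ Finset.range H, v (m + h)‖ ^ 2 : ℝ) : ℂ) =
        ∑ h ∈ Finset.range H, ∑ h' ∈ Finset.range H, ∑ m ∈ Finset.range (N + H),
          v (m + h) * conj (v (m + h')) := by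
      have : ∀ m, ((‖∑ h ∈ Finset.range H, v (m + h)‖ ^ 2 : ℝ) : ℂ) =
          ∑ h ∈ Finset.range H, ∑ h' ∈ Finset.range H, v (m + h) * conj (v (m + h')) := by
        intro m
        rw [ofReal_pow, ← mul_conj', map_sum, Finset.sum_mul_sum]
      rw [ofReal_sum, Finset.sum_congr rfl fun m _ ↦ this m, Finset.sum_comm]
      exact Finset.sum_congr rfl fun h _ ↦ Finset.sum_comm
    have h2 : 0 ≤ ∑ m ∈ Finset.range (N + H), ‖∑ h ∈ Finset.range H, v (m + h)‖ ^ 2 := by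
      positivity
    rw [← Real.norm_of_nonneg h2, ← norm_real, h1]
    have h3 : (H : ℝ) * (2 * ∑ r ∈ Finset.range H, D r) =
        ∑ h ∈ Finset.range H, 2 * ∑ r ∈ Finset.range H, D r := by simp
    rw [h3]
    refine (norm_sum_le _ _).trans (Finset.sum_le_sum fun h hh ↦ (norm_sum_le _ _).trans ?_)
    rw [Finset.mem_range] at hh
    refine le_trans (Finset.sum_le_sum fun h' hh' ↦ ?_)
      (sum_range_dist_le hh fun r ↦ norm_nonneg _)
    rw [norm_sum_shift_mul_conj_le hh (Finset.mem_range.mp hh') hv, hvD]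
  have hcs : ‖∑ m ∈ Finset.range (N + H), ∑ h ∈ Finset.range H, v (m + h)‖ ^ 2 ≤
      ((N : ℝ) + H) * ∑ m ∈ Finset.range (N + H), ‖∑ h ∈ Finset.range H, v (m + h)‖ ^ 2 := by
    refine (pow_le_pow_left₀ (norm_nonneg _) (norm_sum_le _ _) 2).trans ?_
    refine sq_sum_le_card_mul_sum_sq.trans_eq ?_
    rw [Finset.card_range]
    push_cast
    rfl
  rw [← hHS, norm_mul, norm_natCast, mul_pow] at hcs
  have hH' : (0 : ℝ) < H := by exact_mod_cast hH
  have hN : (0 : ℝ) ≤ (N : ℝ) + H := by positivity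
  have hfin := hcs.trans (mul_le_mul_of_nonneg_left hsq hN)
  push_cast
  rw [add_sub_cancel_left]
  refine le_of_mul_le_mul_left ?_ hH'
  calc _ = (H : ℝ) ^ 2 * ‖∑ n ∈ Finset.Ico a (a + N), z n‖ ^ 2 := by ring
    _ ≤ _ := hfin
    _ = _ := by ring

lemma log_second_difference_bounds {x : ℝ} (hx : 0 < x) :
    1 / (x + 1) ^ 2 ≤ 2 * Real.log (x + 1) - Real.log x - Real.log (x + 2) ∧
      2 * Real.log (x + 1) - Real.log x - Real.log (x + 2) ≤ 1 / (x * (x + 2)) := by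
  have heq : 2 * Real.log (x + 1) - Real.log x - Real.log (x + 2) =
      Real.log ((x + 1) ^ 2 / (x * (x + 2))) := by
    rw [Real.log_div (by positivity) (by positivity), Real.log_pow,
      Real.log_mul (by positivity) (by positivity)]
    push_cast
    ring
  have hpos : 0 < (x + 1) ^ 2 / (x * (x + 2)) := by positivity
  rw [heq]
  constructor
  · refine le_trans (le_of_eq ?_) (Real.one_sub_inv_le_log_of_pos hpos)
    field_simp
    ring
  · refine (Real.log_le_sub_one_of_pos hpos).trans (le_of_eq ?_)
    field_simp
    ring

lemma log_shifted_second_difference_bounds {x r : ℝ} (hx : 0 < x) (hr : 0 ≤ r) :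
    r * (2 * x + r + 2) / ((x + 1) ^ 2 * ((x + r) * (x + r + 2))) ≤
      (2 * Real.log (x + 1) - Real.log x - Real.log (x + 2)) -
        (2 * Real.log (x + r + 1) - Real.log (x + r) - Real.log (x + r + 2)) ∧
    (2 * Real.log (x + 1) - Real.log x - Real.log (x + 2)) -
        (2 * Real.log (x + r + 1) - Real.log (x + r) - Real.log (x + r + 2)) ≤
      r * (2 * x + r + 2) / ((x + r + 1) ^ 2 * (x * (x + 2))) := by
  have heq : (2 * Real.log (x + 1) - Real.log x - Real.log (x + 2)) -
        (2 * Real.log (x + r + 1) - Real.log (x + r) - Real.log (x + r + 2)) =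
      Real.log (((x + 1) ^ 2 * ((x + r) * (x + r + 2))) / ((x + r + 1) ^ 2 * (x * (x + 2)))) := by
    rw [Real.log_div (by positivity) (by positivity), Real.log_mul (by positivity) (by positivity),
      Real.log_mul (by positivity) (by positivity), Real.log_mul (by positivity) (by positivity),
      Real.log_mul (by positivity) (by positivity), Real.log_pow, Real.log_pow]
    push_cast
    ring
  have hpos : 0 < ((x + 1) ^ 2 * ((x + r) * (x + r + 2))) /
      ((x + r + 1) ^ 2 * (x * (x + 2))) := by positivity
  rw [heq]
  constructor
  · refine le_trans (le_of_eq ?_) (Real.one_sub_inv_le_log_of_pos hpos)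
    field_simp
    ring
  · refine (Real.log_le_sub_one_of_pos hpos).trans (le_of_eq ?_)
    field_simp
    ring

/-- The phase of `n ^ (-it)` in units of `2π`. -/
noncomputable def zetaPhase (t : ℝ) (n : ℕ) : ℝ := -(t / (2 * Real.pi)) * Real.log n

lemma div_two_pi_bounds {t : ℝ} (ht : 0 ≤ t) :
    t / 7 ≤ t / (2 * Real.pi) ∧ t / (2 * Real.pi) ≤ t / 6 := by
  have h1 := Real.pi_gt_three
  have h2 := Real.pi_lt_d2
  constructor <;> gcongr <;> linarith

/-- First derivative bound for dyadic pieces of length at least `t`. -/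
lemma norm_sum_zetaPhase_le_of_le {t : ℝ} (ht : 0 < t) {M b : ℕ} (hM : t ≤ M)
    (hb : b ≤ 2 * M) : ‖∑ n ∈ Finset.Ico M b, expPhase (zetaPhase t n)‖ ≤ 28 * M / t := by
  have hM0 : (0 : ℝ) < M := ht.trans_le hM
  obtain ⟨hτ1, hτ2⟩ := div_two_pi_bounds ht.le
  set τ := t / (2 * Real.pi) with hτ
  have hθ : 0 < t / (28 * M) := by positivity
  have hinc : ∀ n : ℕ, zetaPhase t (n + 1) - zetaPhase t n =
      -(τ * (Real.log (n + 1) - Real.log n)) := fun n ↦ by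
    simp only [zetaPhase, ← hτ]
    push_cast
    ring
  have hlog : ∀ n : ℕ, M ≤ n → 1 / ((n : ℝ) + 1) ≤ Real.log (n + 1) - Real.log n ∧
      Real.log (n + 1) - Real.log n ≤ 1 / n := by
    intro n hn
    have hn0 : (0 : ℝ) < n := hM0.trans_le (by exact_mod_cast hn)
    rw [← Real.log_div (by positivity) (by positivity)]
    have hpos : 0 < ((n : ℝ) + 1) / n := by positivity
    constructor
    · refine le_trans (le_of_eq ?_) (Real.one_sub_inv_le_log_of_pos hpos)
      field_simp
      ring
    · refine (Real.log_le_sub_one_of_pos hpos).trans (le_of_eq ?_)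
      field_simp
      ring
  have hθ1 : t / (28 * M) ≤ 1 / 28 := by
    rw [div_le_div_iff₀ (by positivity) (by norm_num)]
    linarith
  have := norm_sum_expPhase_le_of_increments (f := zetaPhase t) (a := M) (b := b) (k := -1) hθ
    (fun n h1 h2 ↦ ?_) (fun n h1 h2 ↦ ?_) (fun n h1 h2 ↦ ?_)
  · refine this.trans (le_of_eq ?_)
    field_simp
  · rw [hinc]
    have hn : (M : ℝ) ≤ n := by exact_mod_cast h1
    have h3 : τ * (Real.log (n + 1) - Real.log n) ≤ t / 6 * (1 / M) := by
      refine mul_le_mul hτ2 ((hlog n h1).2.trans ?_) ?_ (by positivity)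
      · gcongr
      · exact le_trans (by positivity) (hlog n h1).1
    have h4 : t / 6 * (1 / M) ≤ 1 / 6 := by
      rw [div_mul_div_comm, div_le_div_iff₀ (by positivity) (by norm_num)]
      linarith
    push_cast
    linarith
  · rw [hinc]
    have hn : (n : ℝ) + 1 ≤ 2 * M := by
      have : n + 1 ≤ 2 * M := by lia
      exact_mod_cast this
    have h3 : t / 7 * (1 / (2 * M)) ≤ τ * (Real.log (n + 1) - Real.log n) := by
      refine mul_le_mul hτ1 (le_trans ?_ (hlog n h1).1) (by positivity) (by positivity)
      gcongr
    have h4 : t / 7 * (1 / (2 * M)) = 2 * (t / (28 * M)) := by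
      field_simp
      norm_num
    push_cast
    linarith
  · have h3 := (log_second_difference_bounds (x := n)
      (hM0.trans_le (by exact_mod_cast h1))).1
    have h4 : 0 ≤ 1 / ((n : ℝ) + 1) ^ 2 := by positivity
    have h5 := hinc (n + 1)
    have h6 : 0 ≤ τ := le_trans (by positivity) hτ1
    rw [hinc, show n + 2 = n + 1 + 1 by ring, h5]
    push_cast
    rw [show (n : ℝ) + 1 + 1 = n + 2 by ring]
    nlinarith [mul_nonneg h6 (h4.trans h3)]

/-- Second derivative bound for dyadic pieces. -/
lemma norm_sum_zetaPhase_le_sqrt {t : ℝ} (ht : 0 < t) {M b : ℕ} (hMb : M ≤ b) (hb : b ≤ 2 * M)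
    (hM : M ≤ t) (hM2 : t ≤ (M : ℝ) ^ 2) (hM0 : 0 < M) :
    ‖∑ n ∈ Finset.Ico M b, expPhase (zetaPhase t n)‖ ≤ 75 * √t := by
  have hM0' : (0 : ℝ) < M := by exact_mod_cast hM0
  obtain ⟨hτ1, hτ2⟩ := div_two_pi_bounds ht.le
  set τ := t / (2 * Real.pi) with hτ
  have hτ0 : 0 < τ := lt_of_lt_of_le (by positivity) hτ1
  set lam := τ / (4 * (M : ℝ) ^ 2) with hlam
  have hlam0 : 0 < lam := by positivity
  have hlam1 : lam ≤ t / (24 * M ^ 2) := by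
    rw [hlam]
    calc τ / (4 * (M : ℝ) ^ 2) ≤ (t / 6) / (4 * (M : ℝ) ^ 2) := by gcongr
      _ = _ := by field_simp; norm_num
  have hlam2 : t / (28 * M ^ 2) ≤ lam := by
    rw [hlam]
    calc t / (28 * (M : ℝ) ^ 2) = (t / 7) / (4 * (M : ℝ) ^ 2) := by field_simp; norm_num
      _ ≤ _ := by gcongr
  have hdiff : ∀ n : ℕ, zetaPhase t (n + 2) - zetaPhase t (n + 1) -
      (zetaPhase t (n + 1) - zetaPhase t n) =
      τ * (2 * Real.log (n + 1) - Real.log n - Real.log (n + 2)) := fun n ↦ by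
    simp only [zetaPhase, ← hτ]
    push_cast
    ring
  have hmain := norm_sum_expPhase_le_of_second_difference (f := zetaPhase t) (a := M) (b := b)
    (c := 4) hMb hlam0 ?_ (by norm_num) (fun n h1 h2 ↦ ?_) (fun n h1 h2 ↦ ?_)
  · refine hmain.trans ?_
    have hsl : 0 < √lam := Real.sqrt_pos.mpr hlam0
    have hst : 0 < √t := Real.sqrt_pos.mpr ht
    have hsl2 : √lam ^ 2 = lam := Real.sq_sqrt hlam0.le
    have hst2 : √t ^ 2 = t := Real.sq_sqrt ht.le
    have h1 : √lam ≤ √t / (4 * M) := by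
      refine Real.sqrt_le_iff.mpr ⟨by positivity, hlam1.trans ?_⟩
      rw [div_pow, hst2, mul_pow]
      gcongr
      norm_num
    have h2 : √t / (6 * M) ≤ √lam := by
      refine Real.le_sqrt_of_sq_le (le_trans ?_ hlam2)
      rw [div_pow, hst2, mul_pow]
      gcongr
      norm_num
    have h3 : ((b : ℝ) - M) ≤ M := by
      have : (b : ℝ) ≤ 2 * M := by exact_mod_cast hb
      linarith
    calc (((b : ℝ) - M) * (4 * lam) + 2) * (5 / √lam)
        ≤ ((M : ℝ) * (4 * lam) + 2) * (5 / √lam) := by gcongr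
      _ = 20 * M * √lam + 10 * (1 / √lam) := by
        nth_rewrite 1 [← hsl2]
        field_simp
        ring
      _ ≤ 20 * M * (√t / (4 * M)) + 10 * (1 / (√t / (6 * M))) := by gcongr
      _ = 5 * √t + 60 * (M / √t) := by field_simp; ring
      _ ≤ 5 * √t + 60 * √t := by
        gcongr
        rw [div_le_iff₀ hst]
        nlinarith
      _ ≤ 75 * √t := by linarith
  · refine hlam1.trans ?_
    rw [div_le_one (by positivity)]
    nlinarith
  · rw [hdiff]
    have hn0 : (0 : ℝ) < n := hM0'.trans_le (by exact_mod_cast h1)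
    have hn : (n : ℝ) + 1 ≤ 2 * M := by
      have : n + 1 ≤ 2 * M := by lia
      exact_mod_cast this
    rw [hlam, div_eq_mul_one_div]
    refine mul_le_mul_of_nonneg_left (le_trans ?_ (log_second_difference_bounds hn0).1) hτ0.le
    refine one_div_le_one_div_of_le (by positivity) ?_
    nlinarith
  · rw [hdiff]
    have hn : (M : ℝ) ≤ n := by exact_mod_cast h1
    have hn0 : (0 : ℝ) < n := hM0'.trans_le hn
    have : 4 * lam = τ * (1 / (M : ℝ) ^ 2) := by rw [hlam]; field_simp
    rw [this]
    refine mul_le_mul_of_nonneg_left ((log_second_difference_bounds hn0).2.trans ?_) hτ0.le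
    refine one_div_le_one_div_of_le (by positivity) ?_
    nlinarith

lemma sum_one_div_sqrt_le (H : ℕ) :
    ∑ r ∈ Finset.Ico 1 H, 1 / √(r : ℝ) ≤ 2 * √(H : ℝ) := by
  refine (Finset.sum_le_sum_of_subset_of_nonneg (Finset.Ico_subset_Ico_right H.le_succ)
    fun r _ _ ↦ by positivity).trans ?_
  induction H with
  | zero => simp
  | succ n ih =>
    rw [Finset.sum_Ico_succ_top (by lia)]
    have hs1 : 0 ≤ √(n : ℝ) := Real.sqrt_nonneg _
    have hs2 : 0 < √((n + 1 : ℕ) : ℝ) := Real.sqrt_pos.mpr (by positivity)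
    have hq1 : √(n : ℝ) ^ 2 = n := Real.sq_sqrt (by positivity)
    have hq2 : √((n + 1 : ℕ) : ℝ) ^ 2 = n + 1 := by
      rw [Real.sq_sqrt (by positivity)]
      push_cast
      ring
    have hstep : 1 / √((n + 1 : ℕ) : ℝ) ≤ 2 * √((n + 1 : ℕ) : ℝ) - 2 * √(n : ℝ) := by
      rw [div_le_iff₀ hs2]
      nlinarith [sq_nonneg (√((n + 1 : ℕ) : ℝ) - √(n : ℝ))]
    linarith

/-- Van der Corput bound for the correlations of `n ^ (-it)` on a dyadic piece. -/
lemma norm_sum_zetaPhase_correlation_le {u : ℝ} (hu : 0 < u) {M b r : ℕ} (hb : b ≤ 2 * M)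
    (huM : u ≤ M) (hr0 : 0 < r) (hr : r * u ≤ M) (hrM : r ≤ M) :
    ‖∑ n ∈ Finset.Ico M (b - r), expPhase (zetaPhase (u ^ 3) n) *
      conj (expPhase (zetaPhase (u ^ 3) (n + r)))‖ ≤
      15 * u + 80 * (M / u * √(M / u)) * (1 / √r) := by
  have hM0 : (0 : ℝ) < M := hu.trans_le huM
  have hr0' : (0 : ℝ) < r := by exact_mod_cast hr0
  have hrM' : (r : ℝ) ≤ M := by exact_mod_cast hrM
  rcases lt_or_ge (b - r) M with hlt | hle
  · rw [Finset.Ico_eq_empty_of_le hlt.le, Finset.sum_empty, norm_zero]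
    positivity
  obtain ⟨hτ1, hτ2⟩ := div_two_pi_bounds (t := u ^ 3) (by positivity)
  set τ := u ^ 3 / (2 * Real.pi) with hτ
  have hτ0 : 0 < τ := lt_of_lt_of_le (by positivity) hτ1
  set lam := τ * r / (9 * (M : ℝ) ^ 3) with hlam
  have hlam0 : 0 < lam := by positivity
  have hlam1 : lam ≤ (u / (7 * M)) ^ 2 := by
    calc lam ≤ (u ^ 3 / 6) * r / (9 * (M : ℝ) ^ 3) := by rw [hlam]; gcongr
      _ = u ^ 2 * (r * u) / (54 * M ^ 3) := by field_simp; norm_num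
      _ ≤ u ^ 2 * M / (49 * M ^ 3) := by gcongr; norm_num
      _ = _ := by field_simp; norm_num
  have hlam2 : u ^ 3 * r / (63 * M ^ 3) ≤ lam := by
    calc u ^ 3 * r / (63 * M ^ 3) = (u ^ 3 / 7) * r / (9 * (M : ℝ) ^ 3) := by
          field_simp; norm_num
      _ ≤ lam := by rw [hlam]; gcongr
  set g : ℕ → ℝ := fun n ↦ zetaPhase (u ^ 3) n - zetaPhase (u ^ 3) (n + r) with hg
  have hz : ∀ n, expPhase (zetaPhase (u ^ 3) n) * conj (expPhase (zetaPhase (u ^ 3) (n + r))) =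
      expPhase (g n) := fun n ↦ by
    rw [conj_expPhase, ← expPhase_add, ← sub_eq_add_neg]
  rw [Finset.sum_congr rfl fun n _ ↦ hz n]
  have hdiff : ∀ n : ℕ, g (n + 2) - g (n + 1) - (g (n + 1) - g n) =
      τ * ((2 * Real.log (n + 1) - Real.log n - Real.log (n + 2)) -
        (2 * Real.log (n + r + 1) - Real.log (n + r) - Real.log (n + r + 2))) := fun n ↦ by
    simp only [hg, zetaPhase, ← hτ]
    push_cast
    rw [show (n : ℝ) + 1 + r = n + r + 1 by ring, show (n : ℝ) + 2 + r = n + r + 2 by ring]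
    ring
  have hmain := norm_sum_expPhase_le_of_second_difference (f := g) (a := M) (b := b - r)
    (c := 18) hle hlam0 ?_ (by norm_num) (fun n h1 h2 ↦ ?_) (fun n h1 h2 ↦ ?_)
  · refine hmain.trans ?_
    have hsl : 0 < √lam := Real.sqrt_pos.mpr hlam0
    have hsl2 : √lam ^ 2 = lam := Real.sq_sqrt hlam0.le
    have h1 : √lam ≤ u / (7 * M) := Real.sqrt_le_iff.mpr ⟨by positivity, hlam1⟩
    have h2 : √r / (8 * (M / u * √(M / u))) ≤ √lam := by
      refine Real.le_sqrt_of_sq_le (le_trans ?_ hlam2)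
      rw [div_pow, mul_pow, mul_pow, Real.sq_sqrt hr0'.le, Real.sq_sqrt (by positivity)]
      have : (r : ℝ) / (8 ^ 2 * ((M / u) ^ 2 * (M / u))) = u ^ 3 * r / (64 * M ^ 3) := by
        field_simp; norm_num
      rw [this]
      gcongr
      norm_num
    have h3 : (((b - r : ℕ) : ℝ) - M) ≤ M := by
      have : b - r ≤ 2 * M := by lia
      have : ((b - r : ℕ) : ℝ) ≤ 2 * M := by exact_mod_cast this
      linarith
    have hsr : 0 < √(r : ℝ) := Real.sqrt_pos.mpr hr0'
    have hsM : 0 < √(M / u) := Real.sqrt_pos.mpr (by positivity)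
    calc ((((b - r : ℕ) : ℝ) - M) * (18 * lam) + 2) * (5 / √lam)
        ≤ ((M : ℝ) * (18 * lam) + 2) * (5 / √lam) := by gcongr
      _ = 90 * M * √lam + 10 * (1 / √lam) := by
        nth_rewrite 1 [← hsl2]
        field_simp
        ring
      _ ≤ 90 * M * (u / (7 * M)) + 10 * (1 / (√r / (8 * (M / u * √(M / u))))) := by gcongr
      _ = 90 / 7 * u + 80 * (M / u * √(M / u)) * (1 / √r) := by field_simp; ring
      _ ≤ _ := by gcongr; norm_num
  · refine hlam1.trans (pow_le_one₀ (by positivity) ?_)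
    rw [div_le_one (by positivity)]
    linarith
  · rw [hdiff]
    have hnM : (M : ℝ) ≤ n := by exact_mod_cast h1
    have hn0 : (0 : ℝ) < n := hM0.trans_le hnM
    have hn1 : (n : ℝ) + 1 ≤ 2 * M := by
      have : n + 1 ≤ 2 * M := by lia
      exact_mod_cast this
    rw [hlam, mul_div_assoc]
    refine mul_le_mul_of_nonneg_left
      (le_trans ?_ (log_shifted_second_difference_bounds hn0 hr0'.le).1) hτ0.le
    have h3 : ((n : ℝ) + r) * (n + r + 2) ≤ (3 * M) ^ 2 := by nlinarith
    calc (r : ℝ) / (9 * (M : ℝ) ^ 3)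
        = r * (2 * ((n : ℝ) + 1)) / (((n : ℝ) + 1) * (2 * M) * (3 * M) ^ 2) := by
          field_simp; norm_num
      _ ≤ r * (2 * n + r + 2) / (((n : ℝ) + 1) ^ 2 * ((n + r) * (n + r + 2))) := by
        gcongr
        · linarith
        · nlinarith
  · rw [hdiff]
    have hnM : (M : ℝ) ≤ n := by exact_mod_cast h1
    have hn0 : (0 : ℝ) < n := hM0.trans_le hnM
    have h18 : 18 * lam = τ * (2 * r / (M : ℝ) ^ 3) := by rw [hlam]; field_simp; norm_num
    rw [h18]
    refine mul_le_mul_of_nonneg_left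
      ((log_shifted_second_difference_bounds hn0 hr0'.le).2.trans ?_) hτ0.le
    calc r * (2 * n + r + 2) / (((n : ℝ) + r + 1) ^ 2 * (n * (n + 2)))
        ≤ r * (2 * (n + r + 1)) / (((n : ℝ) + r + 1) * M * (M * M)) := by
          gcongr
          · linarith
          · rw [sq]
            gcongr
            linarith
          · linarith
      _ = _ := by field_simp

/-- Third derivative bound for dyadic pieces. -/
lemma sq_norm_sum_zetaPhase_le {u : ℝ} (hu : 1 ≤ u) {M b : ℕ} (hMb : M ≤ b) (hb : b ≤ 2 * M)
    (huM : u ≤ M) (hM2 : (M : ℝ) ≤ u ^ 2) :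
    ‖∑ n ∈ Finset.Ico M b, expPhase (zetaPhase (u ^ 3) n)‖ ^ 2 ≤ 1500 * (M * u) := by
  have hu0 : 0 < u := by linarith
  have hM0 : (0 : ℝ) < M := hu0.trans_le huM
  set X : ℝ := M / u with hX
  have hX1 : 1 ≤ X := by rwa [hX, one_le_div hu0]
  have hXM : X ≤ M := div_le_self hM0.le hu
  have hXu : X * u = M := by rw [hX]; field_simp
  set H := ⌊X⌋₊ with hH
  have hH0 : 0 < H := Nat.floor_pos.mpr hX1
  have hHX : (H : ℝ) ≤ X := Nat.floor_le (by linarith)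
  have hHX' : X ≤ 2 * H := by
    have h1 := Nat.lt_floor_add_one X
    have h2 : (1 : ℝ) ≤ H := by exact_mod_cast hH0
    rw [← hH] at h1
    linarith
  have hwvdc := mul_sq_norm_sum_le_sum_correlation
    (fun n ↦ expPhase (zetaPhase (u ^ 3) n)) hMb hH0
  have hbM : (b : ℝ) - M ≤ M := by
    have : (b : ℝ) ≤ 2 * M := by exact_mod_cast hb
    linarith
  have hMb' : (M : ℝ) ≤ b := by exact_mod_cast hMb
  have hcorr : ∑ r ∈ Finset.range H, ‖∑ n ∈ Finset.Ico M (b - r), expPhase (zetaPhase (u ^ 3) n) *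
      conj (expPhase (zetaPhase (u ^ 3) (n + r)))‖ ≤ 176 * M := by
    rw [Finset.range_eq_Ico, Finset.sum_eq_sum_Ico_succ_bot hH0, zero_add]
    have h0 : ‖∑ n ∈ Finset.Ico M (b - 0), expPhase (zetaPhase (u ^ 3) n) *
        conj (expPhase (zetaPhase (u ^ 3) (n + 0)))‖ ≤ M := by
      refine (norm_sum_le _ _).trans ?_
      simp only [norm_mul, RCLike.norm_conj, norm_expPhase, mul_one, Finset.sum_const, tsub_zero,
        Nat.card_Ico, nsmul_eq_mul]
      rwa [Nat.cast_sub hMb]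
    have h1 : ∑ r ∈ Finset.Ico 1 H, ‖∑ n ∈ Finset.Ico M (b - r),
        expPhase (zetaPhase (u ^ 3) n) * conj (expPhase (zetaPhase (u ^ 3) (n + r)))‖ ≤
        ∑ r ∈ Finset.Ico 1 H, (15 * u + 80 * (M / u * √(M / u)) * (1 / √r)) := by
      refine Finset.sum_le_sum fun r hr ↦ ?_
      rw [Finset.mem_Ico] at hr
      have hrX : (r : ℝ) ≤ X := le_trans (by exact_mod_cast hr.2.le) hHX
      refine norm_sum_zetaPhase_correlation_le hu0 hb huM hr.1 ?_ ?_
      · rw [← hXu]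
        gcongr
      · exact_mod_cast hrX.trans hXM
    have h2 : ∑ r ∈ Finset.Ico 1 H, (15 * u + 80 * (M / u * √(M / u)) * (1 / √(r : ℝ))) ≤
        H * (15 * u) + 80 * (M / u * √(M / u)) * (2 * √H) := by
      rw [Finset.sum_add_distrib, Finset.sum_const, Nat.card_Ico, nsmul_eq_mul, ← Finset.mul_sum]
      refine add_le_add ?_ (mul_le_mul_of_nonneg_left (sum_one_div_sqrt_le H) (by positivity))
      gcongr
      exact H.sub_le 1
    have h3 : H * (15 * u) + 80 * (M / u * √(M / u)) * (2 * √H) ≤ 175 * M := by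
      rw [← hX]
      calc H * (15 * u) + 80 * (X * √X) * (2 * √H)
          ≤ X * (15 * u) + 80 * (X * √X) * (2 * √X) := by gcongr
        _ = 15 * (X * u) + 160 * X * √X ^ 2 := by ring
        _ = 15 * M + 160 * (X * X) := by rw [hXu, Real.sq_sqrt (by linarith)]; ring
        _ ≤ 15 * M + 160 * (X * u) := by
          gcongr
          rw [hX, div_le_iff₀ hu0]
          nlinarith
        _ = 175 * M := by rw [hXu]; ring
    linarith
  have hHM : (H : ℝ) ≤ M := hHX.trans hXM
  have hle : (H : ℝ) * ‖∑ n ∈ Finset.Ico M b, expPhase (zetaPhase (u ^ 3) n)‖ ^ 2 ≤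
      2 * (M + M) * (176 * M) := by
    refine hwvdc.trans ?_
    gcongr
  have hH0' : (0 : ℝ) < H := by exact_mod_cast hH0
  refine le_of_mul_le_mul_left (hle.trans ?_) hH0'
  have : (M : ℝ) * M ≤ 2 * H * u * M := by
    have : (M : ℝ) ≤ 2 * H * u := by
      rw [← hXu]
      gcongr
    gcongr
  have h0 : 0 ≤ H * u * M := by positivity
  linarith

/-- The truncation `(s - 1) ∑_{0 < n < N} n ^ (-s) + N ^ (1 - s)` of `(s - 1) ζ(s)`. -/
noncomputable def zetaTruncation (N : ℕ) (s : ℂ) : ℂ :=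
  (s - 1) * ∑ n ∈ Finset.Ico 1 N, (n : ℂ) ^ (-s) + (N : ℂ) ^ (1 - s)

lemma norm_zetaTruncation_succ_sub_le {s : ℂ} {N : ℕ} (hN : 0 < N) (hs : 0 ≤ s.re) :
    ‖zetaTruncation (N + 1) s - zetaTruncation N s‖ ≤
      ‖s‖ * ‖s - 1‖ * (N : ℝ) ^ (-s.re - 1) := by
  have hN' : (0 : ℝ) < N := by exact_mod_cast hN
  set Φ : ℝ → ℂ := fun x ↦ (s - 1) * ((x - (N + 1) : ℝ) : ℂ) * (x : ℂ) ^ (-s) + (x : ℂ) ^ (1 - s)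
    with hΦ
  have heq : zetaTruncation (N + 1) s - zetaTruncation N s = Φ (N + 1) - Φ N := by
    rw [zetaTruncation, zetaTruncation, Finset.sum_Ico_succ_top hN, hΦ]
    push_cast
    ring
  have hderiv : ∀ x ∈ Set.Icc (N : ℝ) (N + 1), HasDerivWithinAt Φ
      (-s * (s - 1) * ((x - (N + 1) : ℝ) : ℂ) * (x : ℂ) ^ (-s - 1)) (Set.Icc (N : ℝ) (N + 1)) x := by
    intro x hx
    have hx0 : 0 < x := hN'.trans_le hx.1
    have hslit : (x : ℂ) ∈ slitPlane := ofReal_mem_slitPlane.mpr hx0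
    have h1 : ∀ w : ℂ, HasDerivAt (fun y : ℝ ↦ (y : ℂ) ^ w) (w * (x : ℂ) ^ (w - 1)) x := by
      intro w
      have := ((hasDerivAt_id (x : ℂ)).cpow_const (c := w) hslit).comp_ofReal
      simpa using this
    have h2 : HasDerivAt (fun y : ℝ ↦ ((y - (N + 1) : ℝ) : ℂ)) 1 x := by
      simpa using ((hasDerivAt_id x).sub_const ((N : ℝ) + 1)).ofReal_comp
    have h3 := ((h2.const_mul (s - 1)).mul (h1 (-s))).add (h1 (1 - s))
    refine (h3.congr_deriv ?_).hasDerivWithinAt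
    rw [show (1 : ℂ) - s - 1 = -s by ring]
    ring
  have hbound : ∀ x ∈ Set.Icc (N : ℝ) (N + 1),
      ‖-s * (s - 1) * ((x - (N + 1) : ℝ) : ℂ) * (x : ℂ) ^ (-s - 1)‖ ≤
        ‖s‖ * ‖s - 1‖ * (N : ℝ) ^ (-s.re - 1) := by
    intro x hx
    have hx0 : 0 < x := hN'.trans_le hx.1
    rw [norm_mul, norm_mul, norm_mul, norm_neg, norm_cpow_eq_rpow_re_of_pos hx0, norm_real]
    have h1 : ‖x - ((N : ℝ) + 1)‖ ≤ 1 := by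
      rw [Real.norm_eq_abs, abs_le]
      constructor <;> linarith [hx.1, hx.2]
    have h2 : x ^ (-s - 1).re ≤ (N : ℝ) ^ (-s.re - 1) := by
      have : (-s - 1).re = -s.re - 1 := by simp
      rw [this]
      exact Real.rpow_le_rpow_of_nonpos hN' hx.1 (by linarith)
    calc ‖s‖ * ‖s - 1‖ * ‖x - ((N : ℝ) + 1)‖ * x ^ (-s - 1).re
        ≤ ‖s‖ * ‖s - 1‖ * 1 * (N : ℝ) ^ (-s.re - 1) := by gcongr
      _ = _ := by ring
  have := (convex_Icc (N : ℝ) (N + 1)).norm_image_sub_le_of_norm_hasDerivWithin_le hderiv hbound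
    (Set.left_mem_Icc.mpr (by linarith)) (Set.right_mem_Icc.mpr (by linarith))
  rw [heq]
  simpa using this

lemma differentiable_zetaTruncation {N : ℕ} (hN : 0 < N) :
    Differentiable ℂ (zetaTruncation N) := by
  unfold zetaTruncation
  have h : ∀ n ∈ Finset.Ico 1 N, Differentiable ℂ fun s : ℂ ↦ (n : ℂ) ^ (-s) := fun n hn ↦ by
    have : (n : ℂ) ≠ 0 := by
      rw [Finset.mem_Ico] at hn
      exact_mod_cast (by lia : n ≠ 0)
    exact (differentiable_id.neg).const_cpow (Or.inl this)
  refine Differentiable.add (Differentiable.mul (by fun_prop) (Differentiable.fun_sum h)) ?_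
  exact ((differentiable_const 1).sub differentiable_id).const_cpow
    (Or.inl (by exact_mod_cast hN.ne'))

lemma zetaTruncation_one (s : ℂ) : zetaTruncation 1 s = 1 := by
  simp [zetaTruncation]

lemma tendsto_zetaTruncation_of_one_lt_re {s : ℂ} (hs : 1 < s.re) :
    Tendsto (fun N ↦ zetaTruncation N s) atTop (nhds (riemannZeta₁ s)) := by
  have hs1 : s ≠ 1 := by
    rintro rfl
    simp at hs
  have hz : riemannZeta₁ s = (s - 1) * riemannZeta s + 0 := by
    rw [riemannZeta_eq_inv_sub_mul hs1, ← mul_assoc, mul_inv_cancel₀ (sub_ne_zero.mpr hs1), one_mul,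
      add_zero]
  rw [hz]
  have hsum : Tendsto (fun N : ℕ ↦ ∑ n ∈ Finset.Ico 1 N, (n : ℂ) ^ (-s)) atTop
      (nhds (riemannZeta s)) := by
    have := ((Complex.summable_one_div_nat_cpow (p := s)).mpr hs).hasSum.tendsto_sum_nat
    rw [← zeta_eq_tsum_one_div_nat_cpow hs] at this
    refine this.congr' ?_
    filter_upwards [eventually_ge_atTop 1] with N hN
    rw [Finset.range_eq_Ico, Finset.sum_eq_sum_Ico_succ_bot hN]
    simp [zero_cpow (Complex.ne_zero_of_one_lt_re hs), cpow_neg]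
  refine (hsum.const_mul _).add ?_
  rw [tendsto_zero_iff_norm_tendsto_zero]
  have h0 : Tendsto (fun N : ℕ ↦ (N : ℝ) ^ (-(s.re - 1))) atTop (nhds 0) :=
    (tendsto_rpow_neg_atTop (by linarith)).comp tendsto_natCast_atTop_atTop
  refine h0.congr' ?_
  filter_upwards [eventually_ge_atTop 1] with N hN
  rw [norm_natCast_cpow_of_pos hN]
  simp

lemma summable_zetaTruncation_bound {s : ℝ} (hs : 0 < s) (C : ℝ) :
    Summable fun n : ℕ ↦ C * ((n + 1 : ℕ) : ℝ) ^ (-s - 1) := by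
  refine Summable.mul_left _ ?_
  rw [summable_nat_add_iff (f := fun n : ℕ ↦ (n : ℝ) ^ (-s - 1)) 1]
  exact Real.summable_nat_rpow.mpr (by linarith)

/-- `ζ` is the limit of its truncations on the half plane `0 < re s`. -/
lemma tendsto_zetaTruncation {s : ℂ} (hs : 0 < s.re) :
    Tendsto (fun N ↦ zetaTruncation N s) atTop (nhds (riemannZeta₁ s)) := by
  set F : ℕ → ℂ → ℂ := fun n s ↦ zetaTruncation (n + 1 + 1) s - zetaTruncation (n + 1) s with hF
  set R := ‖s‖ + 3 with hR
  set U : Set ℂ := {w | s.re / 2 < w.re} ∩ Metric.ball 0 R with hU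
  have hUo : IsOpen U := (isOpen_lt continuous_const continuous_re).inter Metric.isOpen_ball
  have hUc : Convex ℝ U := (convex_halfSpace_re_gt _).inter (convex_ball _ _)
  have hbound : ∀ n, ∀ w ∈ U, ‖F n w‖ ≤
      R * (R + 1) * ((n + 1 : ℕ) : ℝ) ^ (-(s.re / 2) - 1) := by
    rintro n w ⟨hw1, hw2⟩
    rw [mem_ball_zero_iff] at hw2
    have hw1' : s.re / 2 < w.re := hw1
    refine (norm_zetaTruncation_succ_sub_le n.succ_pos (by linarith)).trans ?_
    have h1 : ‖w - 1‖ ≤ R + 1 := (norm_sub_le _ _).trans (by rw [norm_one]; linarith)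
    have h2 : ((n + 1 : ℕ) : ℝ) ^ (-w.re - 1) ≤ ((n + 1 : ℕ) : ℝ) ^ (-(s.re / 2) - 1) :=
      Real.rpow_le_rpow_of_exponent_le (by push_cast; linarith [n.cast_nonneg (α := ℝ)])
        (by linarith)
    gcongr
  have hsummable := summable_zetaTruncation_bound (half_pos hs) (R * (R + 1))
  have hdiff : DifferentiableOn ℂ (fun w ↦ 1 + ∑' n, F n w) U := by
    refine (differentiableOn_const _).add
      (differentiableOn_tsum_of_summable_norm hsummable (fun n ↦ ?_) hUo hbound)
    exact ((differentiable_zetaTruncation (by lia)).sub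
      (differentiable_zetaTruncation (by lia))).differentiableOn
  have htend : ∀ w ∈ U, Tendsto (fun N ↦ zetaTruncation N w) atTop (nhds (1 + ∑' n, F n w)) := by
    intro w hw
    have h1 := (Summable.of_norm_bounded hsummable fun n ↦ hbound n w hw).hasSum.tendsto_sum_nat
    rw [← tendsto_add_atTop_iff_nat 1]
    refine (h1.const_add 1).congr fun N ↦ ?_
    simp only [hF]
    rw [Finset.sum_range_sub (fun n ↦ zetaTruncation (n + 1) w) N, zero_add, zetaTruncation_one]
    ring
  have hsU : s ∈ U := ⟨by simpa using hs, by rw [mem_ball_zero_iff]; linarith⟩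
  have h2R : (2 : ℝ) < R := by linarith [norm_nonneg s]
  have hp : ((max 2 (s.re) : ℝ) : ℂ) ∈ U := by
    refine ⟨?_, ?_⟩
    · show s.re / 2 < (((max 2 s.re : ℝ) : ℂ)).re
      rw [ofReal_re]
      linarith [le_max_right 2 s.re]
    · rw [mem_ball_zero_iff, norm_real, Real.norm_of_nonneg (le_trans (by norm_num)
        (le_max_left _ _)), max_lt_iff]
      exact ⟨h2R, by linarith [re_le_norm s]⟩
  have hev : (fun w ↦ 1 + ∑' n, F n w) =ᶠ[nhds ((max 2 (s.re) : ℝ) : ℂ)] riemannZeta₁ := by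
    have hopen : IsOpen {w : ℂ | 1 < w.re} := isOpen_lt continuous_const continuous_re
    have hmem : ((max 2 (s.re) : ℝ) : ℂ) ∈ {w : ℂ | 1 < w.re} := by
      show 1 < (((max 2 s.re : ℝ) : ℂ)).re
      rw [ofReal_re]
      linarith [le_max_left 2 s.re]
    filter_upwards [hopen.mem_nhds hmem, hUo.mem_nhds hp] with w hw1 hw2
    exact tendsto_nhds_unique (htend w hw2) (tendsto_zetaTruncation_of_one_lt_re hw1)
  have heqOn := (hdiff.analyticOnNhd hUo).eqOn_of_preconnected_of_eventuallyEq
    (differentiable_riemannZeta₁.differentiableOn.analyticOnNhd hUo) hUc.isPreconnected hp hev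
  have h := heqOn hsU
  rw [← h]
  exact htend s hsU

lemma norm_zetaTruncation_sub_le {s : ℂ} (hs : 1 / 2 ≤ s.re) {N K : ℕ} (hN : 0 < N)
    (hNK : N ≤ K) : ‖zetaTruncation K s - zetaTruncation N s‖ ≤
      ‖s‖ * ‖s - 1‖ * (4 / √N - 4 / √K) := by
  induction K, hNK using Nat.le_induction with
  | base => simp
  | succ K hK ih =>
    have hK0 : 0 < K := by lia
    have hK0' : (0 : ℝ) < K := by exact_mod_cast hK0
    have h1 := norm_zetaTruncation_succ_sub_le hK0 (s := s) (by linarith)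
    have h2 : (K : ℝ) ^ (-s.re - 1) ≤ 4 / √K - 4 / √((K + 1 : ℕ) : ℝ) := by
      have ha : 0 < √(K : ℝ) := Real.sqrt_pos.mpr hK0'
      have hb : 0 < √((K + 1 : ℕ) : ℝ) := Real.sqrt_pos.mpr (by positivity)
      have ha2 : √(K : ℝ) ^ 2 = K := Real.sq_sqrt hK0'.le
      have hb2 : √((K + 1 : ℕ) : ℝ) ^ 2 = K + 1 := by
        rw [Real.sq_sqrt (by positivity)]
        push_cast
        ring
      have hK1 : (1 : ℝ) ≤ K := by exact_mod_cast hK0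
      have hexp : (K : ℝ) ^ (-s.re - 1) ≤ 1 / (K * √K) := by
        have : 1 / (K * √(K : ℝ)) = (K : ℝ) ^ (-(1 / 2 : ℝ) - 1) := by
          rw [Real.rpow_sub_one hK0'.ne', Real.rpow_neg hK0'.le, ← Real.sqrt_eq_rpow]
          field_simp
        rw [this]
        exact Real.rpow_le_rpow_of_exponent_le hK1 (by linarith)
      refine hexp.trans ?_
      set A := √(K : ℝ)
      set B := √((K + 1 : ℕ) : ℝ)
      have hAB : (B - A) * (B + A) = 1 := by linarith [mul_self_sub_mul_self B A]
      have hB : B ≤ 3 / 2 * A := by nlinarith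
      have hdiff : 1 / (5 / 2 * A) ≤ B - A := by
        rw [div_le_iff₀ (by positivity)]
        nlinarith
      have hdiff0 : 0 ≤ B - A := le_trans (by positivity) hdiff
      have : 4 / A - 4 / B = 4 * (B - A) / (A * B) := by field_simp
      rw [this, ← ha2]
      calc 1 / (A ^ 2 * A) ≤ 4 * (1 / (5 / 2 * A)) / (A * (3 / 2 * A)) := by
            rw [show 4 * (1 / (5 / 2 * A)) / (A * (3 / 2 * A)) = 16 / 15 * (1 / (A ^ 2 * A)) by
              field_simp; norm_num]
            have : 0 < 1 / (A ^ 2 * A) := by positivity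
            linarith
        _ ≤ 4 * (B - A) / (A * B) := by gcongr
    have h3 : ‖s‖ * ‖s - 1‖ * (K : ℝ) ^ (-s.re - 1) ≤
        ‖s‖ * ‖s - 1‖ * (4 / √K - 4 / √((K + 1 : ℕ) : ℝ)) := by gcongr
    have h4 := norm_sub_le_norm_sub_add_norm_sub (zetaTruncation (K + 1) s) (zetaTruncation K s)
      (zetaTruncation N s)
    linarith

/-- Approximation of `ζ(s)` by a partial sum of its Dirichlet series for `1/2 ≤ re s`. -/
lemma norm_riemannZeta_le_norm_sum_add {s : ℂ} (hs : 1 / 2 ≤ s.re) (hs1 : s ≠ 1) {N : ℕ}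
    (hN : 0 < N) : ‖riemannZeta s‖ ≤ ‖∑ n ∈ Finset.Ico 1 N, (n : ℂ) ^ (-s)‖ +
      (N : ℝ) ^ (1 - s.re) / ‖s - 1‖ + 4 * ‖s‖ / √N := by
  have hsn : 0 < ‖s - 1‖ := norm_pos_iff.mpr (sub_ne_zero.mpr hs1)
  have hlim : ‖riemannZeta₁ s - zetaTruncation N s‖ ≤ ‖s‖ * ‖s - 1‖ * (4 / √N) := by
    refine le_of_tendsto ((tendsto_zetaTruncation (by linarith)).sub_const _).norm ?_
    filter_upwards [eventually_ge_atTop N] with K hK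
    refine (norm_zetaTruncation_sub_le hs hN hK).trans ?_
    have : 0 ≤ 4 / √(K : ℝ) := by positivity
    gcongr
    linarith
  have h1 : ‖riemannZeta₁ s‖ ≤ ‖s‖ * ‖s - 1‖ * (4 / √N) +
      (‖s - 1‖ * ‖∑ n ∈ Finset.Ico 1 N, (n : ℂ) ^ (-s)‖ + (N : ℝ) ^ (1 - s.re)) := by
    refine (norm_le_norm_sub_add _ (zetaTruncation N s)).trans (add_le_add hlim ?_)
    refine (norm_add_le _ _).trans ?_
    rw [norm_mul, norm_natCast_cpow_of_pos hN]
    simp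
  rw [riemannZeta_eq_inv_sub_mul hs1, norm_mul, norm_inv]
  have hN0 : √(N : ℝ) ≠ 0 := (Real.sqrt_pos.mpr (by exact_mod_cast hN)).ne'
  generalize ‖s - 1‖ = d at hsn h1 ⊢
  refine (mul_le_mul_of_nonneg_left h1 (by positivity)).trans_eq ?_
  field_simp
  ring

/-- Abel's inequality. -/
lemma norm_sum_smul_le_of_antitone {w : ℕ → ℝ} {z : ℕ → ℂ} {a : ℕ} {B : ℝ}
    (hw : ∀ n, a ≤ n → w (n + 1) ≤ w n) (hw0 : ∀ n, a ≤ n → 0 ≤ w n) {b : ℕ} (hab : a ≤ b)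
    (hB : ∀ c, a ≤ c → c ≤ b → ‖∑ n ∈ Finset.Ico a c, z n‖ ≤ B) :
    ‖∑ n ∈ Finset.Ico a b, (w n : ℂ) * z n‖ ≤ w a * B := by
  have hab' : ∀ c, a ≤ c → ∑ n ∈ Finset.Ico a c, (w n : ℂ) * z n =
      (w c : ℂ) * ∑ n ∈ Finset.Ico a c, z n + ∑ k ∈ Finset.Ico a c,
        ((w k - w (k + 1) : ℝ) : ℂ) * ∑ n ∈ Finset.Ico a (k + 1), z n := by
    intro c hc
    induction c, hc using Nat.le_induction with
    | base => simp
    | succ c hc ih =>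
      rw [Finset.sum_Ico_succ_top hc, ih, Finset.sum_Ico_succ_top hc, Finset.sum_Ico_succ_top hc,
        Finset.sum_Ico_succ_top hc]
      push_cast
      ring
  have hB0 : 0 ≤ B := (norm_nonneg _).trans (hB a le_rfl hab)
  rw [hab' b hab]
  refine (norm_add_le _ _).trans ?_
  have h1 : ‖(w b : ℂ) * ∑ n ∈ Finset.Ico a b, z n‖ ≤ w b * B := by
    rw [norm_mul, norm_real, Real.norm_of_nonneg (hw0 b hab)]
    exact mul_le_mul_of_nonneg_left (hB b hab le_rfl) (hw0 b hab)
  have h2 : ‖∑ k ∈ Finset.Ico a b,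
      ((w k - w (k + 1) : ℝ) : ℂ) * ∑ n ∈ Finset.Ico a (k + 1), z n‖ ≤
        ∑ k ∈ Finset.Ico a b, (w k - w (k + 1)) * B := by
    refine norm_sum_le_of_le _ fun k hk ↦ ?_
    rw [Finset.mem_Ico] at hk
    have hk0 : 0 ≤ w k - w (k + 1) := sub_nonneg.mpr (hw k hk.1)
    rw [norm_mul, norm_real, Real.norm_of_nonneg hk0]
    exact mul_le_mul_of_nonneg_left (hB _ (by lia) (by lia)) hk0
  have h3 : ∑ k ∈ Finset.Ico a b, (w k - w (k + 1)) = w a - w b := by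
    have := Finset.sum_Ico_sub w hab
    rw [← neg_inj, ← Finset.sum_neg_distrib]
    simpa using this
  rw [← Finset.sum_mul, h3] at h2
  linarith

lemma natCast_cpow_neg_eq {n : ℕ} (hn : n ≠ 0) (σ t : ℝ) :
    (n : ℂ) ^ (-(σ + t * I)) = ((n : ℝ) ^ (-σ) : ℝ) * expPhase (zetaPhase t n) := by
  have hn' : (n : ℂ) ≠ 0 := by exact_mod_cast hn
  rw [neg_add, cpow_add _ _ hn', ofReal_cpow (Nat.cast_nonneg n)]
  congr 1
  · push_cast
    rfl
  · rw [cpow_def_of_ne_zero hn', expPhase, zetaPhase, ← natCast_log]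
    congr 1
    push_cast
    field_simp

lemma norm_sum_Ico_natCast_cpow_le {σ t B : ℝ} (hσ : 0 ≤ σ) {M b : ℕ} (hM : 0 < M) (hMb : M ≤ b)
    (hB : ∀ c, M ≤ c → c ≤ b → ‖∑ n ∈ Finset.Ico M c, expPhase (zetaPhase t n)‖ ≤ B) :
    ‖∑ n ∈ Finset.Ico M b, (n : ℂ) ^ (-(σ + t * I))‖ ≤ (M : ℝ) ^ (-σ) * B := by
  rw [Finset.sum_congr rfl fun n hn ↦ natCast_cpow_neg_eq
    (by have := (Finset.mem_Ico.mp hn).1; lia : n ≠ 0) σ t]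
  refine norm_sum_smul_le_of_antitone (w := fun n ↦ (n : ℝ) ^ (-σ)) (fun n hn ↦ ?_)
    (fun n _ ↦ by positivity) hMb hB
  have : (0 : ℝ) < n := by exact_mod_cast (by lia : 0 < n)
  exact Real.rpow_le_rpow_of_nonpos this (by push_cast; linarith) (by linarith)

/-- Bound for a dyadic block of the Dirichlet series of `ζ` at height `t = u ^ 3`. -/
lemma norm_sum_Ico_two_mul_natCast_cpow_le {σ u : ℝ} (hσ : 1 / 2 ≤ σ) (hu : 1 ≤ u) {M : ℕ}
    (hM : 0 < M) (hMu : (M : ℝ) ≤ 2 * u ^ 6) :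
    ‖∑ n ∈ Finset.Ico M (2 * M), (n : ℂ) ^ (-(σ + (u ^ 3 : ℝ) * I))‖ ≤
      75 * max 1 (u ^ (1 - σ)) := by
  have hu0 : 0 < u := by linarith
  have hM1 : (1 : ℝ) ≤ M := by exact_mod_cast hM
  have hM0 : (0 : ℝ) < M := by linarith
  have hmax1 : 1 ≤ max 1 (u ^ (1 - σ)) := le_max_left _ _
  have hmax2 : u ^ (1 - σ) ≤ max 1 (u ^ (1 - σ)) := le_max_right _ _
  rcases le_or_gt (M : ℝ) u with h1 | h1
  · refine (norm_sum_Ico_natCast_cpow_le (B := M) (by linarith) hM (by lia)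
      fun c hc hcb ↦ ?_).trans ?_
    · refine (norm_sum_le _ _).trans ?_
      simp only [norm_expPhase, Finset.sum_const, Nat.card_Ico, nsmul_eq_mul, mul_one]
      exact_mod_cast (by lia : c - M ≤ M)
    · rw [← Real.rpow_add_one hM0.ne', show -σ + 1 = 1 - σ by ring]
      rcases le_or_gt σ 1 with h | h
      · have := Real.rpow_le_rpow hM0.le h1 (by linarith : 0 ≤ 1 - σ)
        linarith
      · have := Real.rpow_le_one_of_one_le_of_nonpos hM1 (by linarith : 1 - σ ≤ 0)
        linarith
  have hsplit : ∀ x : ℝ, 0 < x → x ^ (-σ) = x ^ (1 / 2 - σ) / √x := fun x hx ↦ by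
    rw [Real.sqrt_eq_rpow, ← Real.rpow_sub hx]
    ring_nf
  have husplit : u ^ (1 - σ) = u ^ (1 / 2 - σ) * √u := by
    rw [Real.sqrt_eq_rpow, ← Real.rpow_add hu0]
    ring_nf
  have hMle : (M : ℝ) ^ (1 / 2 - σ) ≤ u ^ (1 / 2 - σ) :=
    Real.rpow_le_rpow_of_nonpos hu0 h1.le (by linarith)
  rcases le_or_gt (M : ℝ) (u ^ 2) with h2 | h2
  · refine (norm_sum_Ico_natCast_cpow_le (B := √(1500 * (M * u))) (by linarith) hM (by lia)
      fun c hc hcb ↦ ?_).trans ?_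
    · exact Real.le_sqrt_of_sq_le (sq_norm_sum_zetaPhase_le hu hc hcb h1.le h2)
    · have h3 : √(1500 * (M * u)) ≤ 40 * (√M * √u) := by
        rw [← Real.sqrt_mul hM0.le]
        refine Real.sqrt_le_iff.mpr ⟨by positivity, ?_⟩
        rw [mul_pow, Real.sq_sqrt (by positivity)]
        nlinarith [mul_pos hM0 hu0]
      have hsM : 0 < √(M : ℝ) := Real.sqrt_pos.mpr hM0
      calc (M : ℝ) ^ (-σ) * √(1500 * (M * u)) ≤ (M : ℝ) ^ (-σ) * (40 * (√M * √u)) := by gcongr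
        _ = 40 * ((M : ℝ) ^ (1 / 2 - σ) * √u) := by
          rw [hsplit M hM0]
          field_simp
        _ ≤ 40 * u ^ (1 - σ) := by
          rw [husplit]
          gcongr
        _ ≤ _ := by linarith
  rcases le_or_gt (M : ℝ) (u ^ 3) with h3 | h3
  · have hu3 : u ^ 3 ≤ (M : ℝ) ^ 2 := by
      calc u ^ 3 ≤ (u ^ 2) ^ 2 := by
            rw [← pow_mul]
            exact pow_le_pow_right₀ hu (by norm_num)
        _ ≤ _ := by gcongr
    refine (norm_sum_Ico_natCast_cpow_le (B := 75 * √(u ^ 3)) (by linarith) hM (by lia)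
      fun c hc hcb ↦ norm_sum_zetaPhase_le_sqrt (by positivity) hc hcb h3 hu3 hM).trans ?_
    have h4 : √(u ^ 3) = u * √u := by
      rw [show u ^ 3 = u ^ 2 * u by ring, Real.sqrt_mul (by positivity), Real.sqrt_sq hu0.le]
    have h5 : u ≤ √(M : ℝ) := Real.le_sqrt_of_sq_le h2.le
    have hsM : 0 < √(M : ℝ) := Real.sqrt_pos.mpr hM0
    calc (M : ℝ) ^ (-σ) * (75 * √(u ^ 3)) = 75 * ((M : ℝ) ^ (1 / 2 - σ) * √u * (u / √M)) := by
          rw [hsplit M hM0, h4]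
          field_simp
      _ ≤ 75 * (u ^ (1 / 2 - σ) * √u * 1) := by
          have : u / √(M : ℝ) ≤ 1 := (div_le_one hsM).mpr h5
          gcongr
      _ = 75 * u ^ (1 - σ) := by rw [husplit, mul_one]
      _ ≤ _ := by linarith
  · refine (norm_sum_Ico_natCast_cpow_le (B := 28 * M / u ^ 3) (by linarith) hM (by lia)
      fun c hc hcb ↦ norm_sum_zetaPhase_le_of_le (by positivity) h3.le hcb).trans ?_
    have h4 : (M : ℝ) ^ (-σ) ≤ 1 / √M := by
      rw [hsplit M hM0]
      gcongr
      exact Real.rpow_le_one_of_one_le_of_nonpos hM1 (by linarith)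
    have hsM : 0 < √(M : ℝ) := Real.sqrt_pos.mpr hM0
    have h5 : √(M : ℝ) ≤ 2 * u ^ 3 := by
      refine Real.sqrt_le_iff.mpr ⟨by positivity, ?_⟩
      nlinarith [pow_pos hu0 6]
    calc (M : ℝ) ^ (-σ) * (28 * M / u ^ 3) ≤ 1 / √M * (28 * M / u ^ 3) := by gcongr
      _ = 28 * (√M / u ^ 3) := by
        field_simp
        rw [Real.sq_sqrt hM0.le]
      _ ≤ 28 * 2 := by
        gcongr
        rw [div_le_iff₀ (by positivity)]
        exact h5
      _ ≤ _ := by linarith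

lemma norm_sum_Ico_one_two_pow_le {f : ℕ → ℂ} {B : ℝ} {K : ℕ}
    (hB : ∀ k < K, ‖∑ n ∈ Finset.Ico (2 ^ k) (2 * 2 ^ k), f n‖ ≤ B) :
    ‖∑ n ∈ Finset.Ico 1 (2 ^ K), f n‖ ≤ K * B := by
  induction K with
  | zero => simp
  | succ K ih =>
    rw [← Finset.sum_Ico_consecutive f (Nat.one_le_two_pow (n := K))
      (Nat.pow_le_pow_right two_pos K.le_succ), pow_succ']
    refine (norm_add_le _ _).trans ?_
    have h1 := ih fun k hk ↦ hB k (by lia)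
    have h2 := hB K (by lia)
    push_cast
    linarith

lemma norm_riemannZeta_le_of_re_le_two {ε σ t : ℝ} (hε : 0 < ε) (hσ : 1 / 2 ≤ σ) (hσ2 : σ ≤ 2)
    (hσε : σ ≤ 1 + ε) (ht : 1 ≤ t) :
    ‖riemannZeta (σ + t * I)‖ ≤ 75 * (1 + 6 / ε) * t ^ ((1 - σ) / 3 + ε) + 14 := by
  have ht0 : 0 < t := by linarith
  set u : ℝ := t ^ (1 / 3 : ℝ) with hu
  have hu1 : 1 ≤ u := Real.one_le_rpow ht (by norm_num)
  have hu3 : u ^ 3 = t := by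
    rw [hu, ← Real.rpow_natCast, ← Real.rpow_mul ht0.le]
    norm_num
  obtain ⟨n, hn1, hn2⟩ := exists_nat_pow_near (one_le_pow₀ ht : 1 ≤ t ^ 2) (one_lt_two : (1 : ℝ) < 2)
  set s : ℂ := σ + t * I with hs
  have hre : s.re = σ := by simp [hs]
  have him : (s - 1).im = t := by simp [hs]
  have hsub : t ≤ ‖s - 1‖ := by
    have := abs_im_le_norm (s - 1)
    rw [him] at this
    exact (le_abs_self t).trans this
  have hs1 : s ≠ 1 := by
    intro h
    rw [h, sub_self, norm_zero] at hsub
    linarith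
  have hsnorm : ‖s‖ ≤ 3 * t := by
    refine (norm_add_le _ _).trans ?_
    rw [norm_mul, norm_I, norm_real, norm_real, Real.norm_of_nonneg (by linarith),
      Real.norm_of_nonneg ht0.le]
    linarith
  have hblock : ∀ k < n + 1, ‖∑ m ∈ Finset.Ico (2 ^ k : ℕ) (2 * 2 ^ k), (m : ℂ) ^ (-s)‖ ≤
      75 * max 1 (u ^ (1 - σ)) := by
    intro k hk
    have h := norm_sum_Ico_two_mul_natCast_cpow_le hσ hu1 (M := 2 ^ k) (by positivity) (by
      have h2 : (2 : ℝ) ^ k ≤ 2 ^ n := pow_le_pow_right₀ one_le_two (by lia)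
      have h6 : u ^ 6 = t ^ 2 := by rw [← hu3]; ring
      rw [h6]
      push_cast
      nlinarith)
    rwa [hu3] at h
  have happrox := norm_riemannZeta_le_norm_sum_add (s := s) (by rwa [hre]) hs1
    (N := 2 ^ (n + 1)) (by positivity)
  have hN : t ≤ √((2 ^ (n + 1) : ℕ) : ℝ) := Real.le_sqrt_of_sq_le (by push_cast; exact hn2.le)
  have hN2 : √((2 ^ (n + 1) : ℕ) : ℝ) ≤ 2 * t := by
    refine Real.sqrt_le_iff.mpr ⟨by positivity, ?_⟩
    push_cast
    rw [pow_succ]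
    nlinarith
  have herr1 : ((2 ^ (n + 1) : ℕ) : ℝ) ^ (1 - s.re) / ‖s - 1‖ ≤ 2 := by
    rw [div_le_iff₀ (ht0.trans_le hsub), hre]
    have : ((2 ^ (n + 1) : ℕ) : ℝ) ^ (1 - σ) ≤ √((2 ^ (n + 1) : ℕ) : ℝ) := by
      rw [Real.sqrt_eq_rpow]
      exact Real.rpow_le_rpow_of_exponent_le (by exact_mod_cast Nat.one_le_two_pow) (by linarith)
    linarith
  have herr2 : 4 * ‖s‖ / √((2 ^ (n + 1) : ℕ) : ℝ) ≤ 12 := by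
    rw [div_le_iff₀ (ht0.trans_le hN)]
    linarith
  have hn : ((n + 1 : ℕ) : ℝ) ≤ (1 + 6 / ε) * t ^ (2 * ε / 3) := by
    have h1 : n * Real.log 2 ≤ 2 * Real.log t := by
      have := Real.log_le_log (by positivity) hn1
      rwa [Real.log_pow, Real.log_pow, Nat.cast_ofNat] at this
    have h2 : Real.log t ≤ t ^ (2 * ε / 3) / (2 * ε / 3) :=
      Real.log_le_rpow_div ht0.le (by positivity)
    have h3 : (1 : ℝ) ≤ t ^ (2 * ε / 3) := Real.one_le_rpow ht (by positivity)
    have h4 : (n : ℝ) ≤ 4 * Real.log t := by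
      nlinarith [Real.log_two_gt_d9, n.cast_nonneg (α := ℝ)]
    have h5 : 4 * (t ^ (2 * ε / 3) / (2 * ε / 3)) = 6 / ε * t ^ (2 * ε / 3) := by
      field_simp
      norm_num
    push_cast
    linarith
  have hmax : t ^ (2 * ε / 3) * max 1 (u ^ (1 - σ)) ≤ t ^ ((1 - σ) / 3 + ε) := by
    rw [mul_max_of_nonneg _ _ (by positivity), hu, ← Real.rpow_mul ht0.le, ← Real.rpow_add ht0,
      mul_one]
    exact max_le (Real.rpow_le_rpow_of_exponent_le ht (by linarith))
      (Real.rpow_le_rpow_of_exponent_le ht (by linarith))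
  have hsum : ‖∑ m ∈ Finset.Ico (1 : ℕ) (2 ^ (n + 1)), (m : ℂ) ^ (-s)‖ ≤
      75 * (1 + 6 / ε) * t ^ ((1 - σ) / 3 + ε) := by
    calc _ ≤ ((n + 1 : ℕ) : ℝ) * (75 * max 1 (u ^ (1 - σ))) := norm_sum_Ico_one_two_pow_le hblock
      _ ≤ (1 + 6 / ε) * t ^ (2 * ε / 3) * (75 * max 1 (u ^ (1 - σ))) := by gcongr
      _ = 75 * (1 + 6 / ε) * (t ^ (2 * ε / 3) * max 1 (u ^ (1 - σ))) := by ring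
      _ ≤ _ := by gcongr
  linarith

lemma norm_riemannZeta_le_tsum {δ : ℝ} (hδ : 1 < δ) {s : ℂ} (hs : δ ≤ s.re) :
    ‖riemannZeta s‖ ≤ ∑' n : ℕ, 1 / ((n + 1 : ℕ) : ℝ) ^ δ := by
  rw [zeta_eq_tsum_one_div_nat_add_one_cpow (hδ.trans_le hs)]
  have hsum : Summable fun n : ℕ ↦ 1 / ((n + 1 : ℕ) : ℝ) ^ δ := by
    rw [summable_nat_add_iff (f := fun n : ℕ ↦ 1 / (n : ℝ) ^ δ) 1]
    exact Real.summable_one_div_nat_rpow.mpr hδ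
  refine tsum_of_norm_bounded hsum.hasSum fun n ↦ ?_
  have h := norm_natCast_cpow_of_pos n.succ_pos s
  rw [Nat.succ_eq_add_one, Nat.cast_add_one] at h
  rw [norm_div, norm_one, h]
  have : ((n : ℝ) + 1) ^ δ ≤ ((n : ℝ) + 1) ^ s.re :=
    Real.rpow_le_rpow_of_exponent_le (by linarith [n.cast_nonneg (α := ℝ)]) hs
  push_cast
  gcongr

lemma norm_riemannZeta_conj (s : ℂ) : ‖riemannZeta (conj s)‖ = ‖riemannZeta s‖ := by
  rw [riemannZeta_conj, norm_conj]

/-- For every fixed `ε > 0`, `ζ(σ + it) ≪_ε 1 + |t| ^ ((1-σ)/3 + ε)`, uniformly for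
`σ ≥ 1/2` and `|t| ≥ 1`. -/
theorem riemannZeta_convexity_bound (ε : ℝ) (hε : 0 < ε) :
    ∃ C : ℝ, ∀ σ t : ℝ, 1 / 2 ≤ σ → 1 ≤ |t| →
      ‖riemannZeta (σ + t * Complex.I)‖ ≤ C * (1 + |t| ^ ((1 - σ) / 3 + ε)) := by
  set D : ℝ := ∑' n : ℕ, 1 / ((n + 1 : ℕ) : ℝ) ^ (1 + min ε 1) with hD
  have hD0 : 0 ≤ D := tsum_nonneg fun n ↦ by positivity
  refine ⟨75 * (1 + 6 / ε) + D + 14, fun σ t hσ ht ↦ ?_⟩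
  have ht0 : 0 < |t| := by linarith
  have hT : 0 ≤ |t| ^ ((1 - σ) / 3 + ε) := by positivity
  have habs : ‖riemannZeta (σ + t * I)‖ = ‖riemannZeta (σ + (|t| : ℝ) * I)‖ := by
    rcases abs_choice t with h | h
    · rw [h]
    · rw [h, ← norm_riemannZeta_conj]
      simp
  rw [habs]
  generalize |t| = x at *
  have hc : 0 ≤ 75 * (1 + 6 / ε) := by positivity
  rcases le_total σ (1 + min ε 1) with h | h
  · have h1 := norm_riemannZeta_le_of_re_le_two hε hσ (by linarith [min_le_right ε 1])
      (by linarith [min_le_left ε 1]) ht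
    nlinarith
  · have h1 := norm_riemannZeta_le_tsum (δ := 1 + min ε 1) (by linarith [lt_min hε one_pos])
      (s := σ + x * I) (by simpa using h)
    nlinarith
end

section
/- Let χ be a Dirichlet character and L(s, χ) the associated Dirichlet L-function. For every fixed ε > 0, one has L(σ + it, χ) ≪_{χ,ε} 1 + |t|^{(1-σ)/2 + ε}, uniformly for σ ≥ 1/2 and |t| ≥ 1. -/
open Complex Filter Asymptotics

lemma one_add_abs_rpow_mul_exp_neg_sq_le {α : ℝ} (hα : 0 ≤ α) (t t₀ : ℝ) :
    (1 + |t|) ^ α * Real.exp (-(t - t₀) ^ 2) ≤ Real.exp (α ^ 2) * (1 + |t₀|) ^ α := by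
  have h₁ : 1 + |t| ≤ (1 + |t₀|) * (1 + |t - t₀|) := by
    have : |t| ≤ |t₀| + |t - t₀| := by
      simpa using abs_add_le t₀ (t - t₀)
    nlinarith [mul_nonneg (abs_nonneg t₀) (abs_nonneg (t - t₀))]
  have h₂ : (1 + |t - t₀|) ^ α ≤ Real.exp (α * |t - t₀|) := by
    rw [mul_comm, Real.exp_mul]
    exact Real.rpow_le_rpow (by positivity)
      (by linarith [Real.add_one_le_exp |t - t₀|]) hα
  calc (1 + |t|) ^ α * Real.exp (-(t - t₀) ^ 2)
      ≤ ((1 + |t₀|) ^ α * Real.exp (α * |t - t₀|)) * Real.exp (-(t - t₀) ^ 2) := by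
        gcongr
        calc (1 + |t|) ^ α ≤ ((1 + |t₀|) * (1 + |t - t₀|)) ^ α :=
              Real.rpow_le_rpow (by positivity) h₁ hα
          _ = (1 + |t₀|) ^ α * (1 + |t - t₀|) ^ α :=
              Real.mul_rpow (by positivity) (by positivity)
          _ ≤ _ := by gcongr
    _ = Real.exp (α * |t - t₀| - (t - t₀) ^ 2) * (1 + |t₀|) ^ α := by
        rw [sub_eq_add_neg (α * _), Real.exp_add]; ring
    _ ≤ _ := by
        gcongr
        rw [← sq_abs (t - t₀)]
        nlinarith [sq_nonneg (α - |t - t₀|), sq_nonneg α, sq_nonneg (|t - t₀|)]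

lemma norm_cexp_sub_mul_I_sq (s : ℂ) (t₀ : ℝ) :
    ‖cexp ((s - t₀ * I) ^ 2)‖ = Real.exp (s.re ^ 2) * Real.exp (-(s.im - t₀) ^ 2) := by
  rw [Complex.norm_exp, ← Real.exp_add]
  congr 1
  simp [pow_two]
  ring

/-- Convexity principle in a vertical strip: polynomial bounds on the two edges interpolate
linearly in the exponent. -/
theorem exists_norm_le_one_add_abs_im_rpow_of_strip {f : ℂ → ℂ} {l u α β A B K k : ℝ}
    (hlu : l < u) (hα : 0 ≤ α) (hβ : 0 ≤ β) (hk : 0 ≤ k)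
    (hd : DiffContOnCl ℂ f (HadamardThreeLines.verticalStrip l u))
    (hK : ∀ s : ℂ, l ≤ s.re → s.re ≤ u → ‖f s‖ ≤ K * Real.exp (k * |s.im|))
    (hA : ∀ s : ℂ, s.re = l → ‖f s‖ ≤ A * (1 + |s.im|) ^ α)
    (hB : ∀ s : ℂ, s.re = u → ‖f s‖ ≤ B * (1 + |s.im|) ^ β) :
    ∃ C : ℝ, ∀ s : ℂ, l ≤ s.re → s.re ≤ u →
      ‖f s‖ ≤ C * (1 + |s.im|) ^
        (α * (1 - (s.re - l) / (u - l)) + β * ((s.re - l) / (u - l))) := by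
  set D : ℝ := max 1 (max (A * Real.exp (l ^ 2) * Real.exp (α ^ 2))
    (B * Real.exp (u ^ 2) * Real.exp (β ^ 2)))
  have hD0 : 0 < D := lt_of_lt_of_le one_pos (le_max_left _ _)
  refine ⟨D, fun s₀ hl hu ↦ ?_⟩
  set t₀ := s₀.im
  set T : ℝ := 1 + |t₀|
  have hT0 : 0 < T := by positivity
  set g : ℂ → ℂ := fun s ↦ f s * cexp ((s - t₀ * I) ^ 2) with hg
  have edge {x γ E : ℝ} (hγ : 0 ≤ γ) (hE : E * Real.exp (x ^ 2) * Real.exp (γ ^ 2) ≤ D)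
      (h : ∀ s : ℂ, s.re = x → ‖f s‖ ≤ E * (1 + |s.im|) ^ γ) (s : ℂ) (hs : s.re = x) :
      ‖g s‖ ≤ D * T ^ γ := by
    have hE0 : 0 ≤ E := by
      have := (norm_nonneg _).trans (h s hs)
      exact nonneg_of_mul_nonneg_left this (by positivity)
    rw [hg, norm_mul, norm_cexp_sub_mul_I_sq, hs]
    calc ‖f s‖ * (Real.exp (x ^ 2) * Real.exp (-(s.im - t₀) ^ 2))
        ≤ (E * (1 + |s.im|) ^ γ) * (Real.exp (x ^ 2) * Real.exp (-(s.im - t₀) ^ 2)) := by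
          gcongr; exact h s hs
      _ = E * Real.exp (x ^ 2) * ((1 + |s.im|) ^ γ * Real.exp (-(s.im - t₀) ^ 2)) := by ring
      _ ≤ E * Real.exp (x ^ 2) * (Real.exp (γ ^ 2) * T ^ γ) := by
          exact mul_le_mul_of_nonneg_left (one_add_abs_rpow_mul_exp_neg_sq_le hγ _ _)
            (by positivity)
      _ = (E * Real.exp (x ^ 2) * Real.exp (γ ^ 2)) * T ^ γ := by ring
      _ ≤ _ := by gcongr
  have hbdd : BddAbove ((norm ∘ g) '' HadamardThreeLines.verticalClosedStrip l u) := by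
    have hK0 : 0 ≤ K := nonneg_of_mul_nonneg_left ((norm_nonneg _).trans (hK s₀ hl hu))
      (by positivity)
    refine ⟨K * Real.exp (l ^ 2 + u ^ 2) * Real.exp (k * |t₀| + k ^ 2), ?_⟩
    rintro _ ⟨s, hs, rfl⟩
    obtain ⟨h₁, h₂⟩ : l ≤ s.re ∧ s.re ≤ u := hs
    simp only [hg, Function.comp_apply, norm_mul, norm_cexp_sub_mul_I_sq]
    calc ‖f s‖ * (Real.exp (s.re ^ 2) * Real.exp (-(s.im - t₀) ^ 2))
        ≤ (K * Real.exp (k * |s.im|)) *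
            (Real.exp (l ^ 2 + u ^ 2) * Real.exp (-(s.im - t₀) ^ 2)) := by
          gcongr
          · exact hK s h₁ h₂
          · rcases le_total 0 s.re with h | h <;> nlinarith [sq_nonneg l, sq_nonneg u]
      _ = K * Real.exp (l ^ 2 + u ^ 2) * Real.exp (k * |s.im| + -(s.im - t₀) ^ 2) := by
          rw [Real.exp_add (k * |s.im|)]; ring
      _ ≤ _ := by
          refine mul_le_mul_of_nonneg_left (Real.exp_le_exp.mpr ?_) (by positivity)
          have : |s.im| ≤ |t₀| + |s.im - t₀| := by simpa using abs_add_le t₀ (s.im - t₀)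
          rw [← sq_abs (s.im - t₀)]
          nlinarith [sq_nonneg (k - |s.im - t₀|), sq_nonneg k, sq_nonneg (|s.im - t₀|),
            mul_le_mul_of_nonneg_left this hk]
  have hgd : DiffContOnCl ℂ g (HadamardThreeLines.verticalStrip l u) :=
    hd.smul (Differentiable.diffContOnCl
      (by fun_prop : Differentiable ℂ fun s : ℂ ↦ cexp ((s - t₀ * I) ^ 2)))
  have key := HadamardThreeLines.norm_le_interp_of_mem_verticalClosedStrip' hlu
    (z := s₀) ⟨hl, hu⟩ hgd hbdd
    (edge hα ((le_max_left _ _).trans (le_max_right _ _)) hA)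
    (edge hβ ((le_max_right _ _).trans (le_max_right _ _)) hB)
  have h₀ : ‖f s₀‖ ≤ ‖g s₀‖ := by
    rw [hg, norm_mul, norm_cexp_sub_mul_I_sq, sub_self]
    refine le_mul_of_one_le_right (norm_nonneg _) ?_
    simp only [ne_eq, OfNat.ofNat_ne_zero, not_false_eq_true, zero_pow, neg_zero, Real.exp_zero,
      mul_one, Real.one_le_exp_iff]
    positivity
  refine h₀.trans (key.trans_eq ?_)
  rw [Real.mul_rpow hD0.le (by positivity), Real.mul_rpow hD0.le (by positivity),
    mul_mul_mul_comm, ← Real.rpow_add hD0, sub_add_cancel, Real.rpow_one,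
    ← Real.rpow_mul hT0.le, ← Real.rpow_mul hT0.le, ← Real.rpow_add hT0]

lemma norm_Gamma_le_Gamma_re {s : ℂ} (hs : 0 < s.re) : ‖Gamma s‖ ≤ Real.Gamma s.re := by
  rw [Gamma_eq_integral hs, Real.Gamma_eq_integral hs]
  refine MeasureTheory.norm_integral_le_of_norm_le (Real.GammaIntegral_convergent hs) ?_
  filter_upwards [MeasureTheory.ae_restrict_mem measurableSet_Ioi] with x hx
  rw [norm_mul, norm_cpow_eq_rpow_re_of_pos hx, Complex.norm_real, Real.norm_eq_abs,
    abs_of_pos (Real.exp_pos _)]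
  simp

lemma norm_sq_Gamma_of_re_eq_half {s : ℂ} (hs : s.re = 1 / 2) :
    ‖Gamma s‖ ^ 2 = Real.pi / Real.cosh (Real.pi * s.im) := by
  have hconj : (starRingEnd ℂ) s = 1 - s := by
    apply Complex.ext <;> simp [hs]; norm_num
  have h := Complex.Gamma_mul_Gamma_one_sub s
  rw [← hconj, Gamma_conj, mul_conj, normSq_eq_norm_sq] at h
  have hsin : sin (Real.pi * s) = Real.cosh (Real.pi * s.im) := by
    have : (Real.pi : ℂ) * s = (Real.pi * s.im : ℝ) * I + Real.pi / 2 := by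
      conv_lhs => rw [← re_add_im s, hs]
      push_cast; ring
    rw [this, Complex.sin_add_pi_div_two, Complex.cos_mul_I, ofReal_cosh]
  rw [hsin] at h
  exact_mod_cast h

lemma norm_Gamma_mul_exp_le_of_re_eq_half {s : ℂ} (hs : s.re = 1 / 2) :
    ‖Gamma s‖ * Real.exp (Real.pi * |s.im| / 2) ≤ 3 := by
  refine abs_le_of_sq_le_sq' ?_ (by norm_num) |>.2
  rw [mul_pow, norm_sq_Gamma_of_re_eq_half hs, ← Real.exp_nat_mul, div_mul_eq_mul_div,
    div_le_iff₀ (Real.cosh_pos _), ← Real.cosh_abs, abs_mul, abs_of_pos Real.pi_pos,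
    Real.cosh_eq]
  have h₁ : ((2 : ℕ) : ℝ) * (Real.pi * |s.im| / 2) = Real.pi * |s.im| := by push_cast; ring
  rw [h₁]
  nlinarith [Real.pi_lt_four, Real.exp_pos (Real.pi * |s.im|), Real.exp_pos (-(Real.pi * |s.im|))]

/-- An upper bound of Stirling quality for the Gamma function on a vertical strip. -/
lemma exists_norm_Gamma_mul_exp_le :
    ∃ C : ℝ, 0 ≤ C ∧ ∀ s : ℂ, 1 / 2 ≤ s.re → s.re ≤ 3 / 2 →
      ‖Gamma s‖ * Real.exp (Real.pi * |s.im| / 2) ≤ C * (1 + |s.im|) ^ (s.re - 1 / 2) := by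
  obtain ⟨K, hK⟩ : ∃ K : ℝ, ∀ x ∈ Set.Icc (1 / 2 : ℝ) (3 / 2), Real.Gamma x ≤ K := by
    have hc : ContinuousOn Real.Gamma (Set.Icc (1 / 2 : ℝ) (3 / 2)) := fun x hx ↦
      (Real.differentiableAt_Gamma fun m ↦ by
        have : (0 : ℝ) ≤ m := m.cast_nonneg
        linarith [hx.1]).continuousAt.continuousWithinAt
    obtain ⟨K, hK⟩ := isCompact_Icc.bddAbove_image hc
    exact ⟨K, fun x hx ↦ hK ⟨x, hx, rfl⟩⟩
  have signed (η : ℝ) (hη : |η| = 1) : ∃ C : ℝ, ∀ s : ℂ, 1 / 2 ≤ s.re → s.re ≤ 3 / 2 →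
      ‖Gamma s‖ * Real.exp (η * (Real.pi * s.im / 2)) ≤ C * (1 + |s.im|) ^ (s.re - 1 / 2) := by
    have hnorm (s : ℂ) : ‖Gamma s * cexp (-(η * (Real.pi / 2) * I * s))‖
        = ‖Gamma s‖ * Real.exp (η * (Real.pi * s.im / 2)) := by
      rw [norm_mul, Complex.norm_exp]
      congr 2
      simp
      ring
    have hexp (s : ℂ) : Real.exp (η * (Real.pi * s.im / 2)) ≤
        Real.exp (Real.pi * |s.im| / 2) := by
      gcongr
      refine (le_abs_self _).trans_eq ?_
      rw [abs_mul, hη, one_mul, abs_div, abs_mul, abs_of_pos Real.pi_pos, abs_two]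
    refine
      (exists_norm_le_one_add_abs_im_rpow_of_strip
        (f := fun s ↦ Gamma s * cexp (-(η * (Real.pi / 2) * I * s))) (l := 1 / 2) (u := 3 / 2)
        (α := 0) (β := 1) (A := 3) (B := 3) (K := K) (k := Real.pi / 2) (by norm_num) le_rfl
        zero_le_one (by positivity) ?_ ?_ ?_ ?_).imp fun C hC s h₁ h₂ ↦ by
          have := hC s h₁ h₂
          rw [hnorm] at this
          convert this using 3
          ring
    · refine DifferentiableOn.diffContOnCl fun s hs ↦ ?_
      have hs : 1 / 2 ≤ s.re := by
        have : s ∈ re ⁻¹' Set.Icc (1 / 2) (3 / 2) :=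
          closure_minimal (Set.preimage_mono Set.Ioo_subset_Icc_self)
            (isClosed_Icc.preimage continuous_re) hs
        exact this.1
      refine DifferentiableAt.differentiableWithinAt (.mul ?_ (by fun_prop))
      refine differentiableAt_Gamma s fun m h ↦ ?_
      have : (0 : ℝ) ≤ m := m.cast_nonneg
      rw [h] at hs
      simp at hs
      linarith
    · intro s h₁ h₂
      rw [hnorm]
      have hΓ := (norm_Gamma_le_Gamma_re (by linarith)).trans (hK _ ⟨h₁, h₂⟩)
      refine mul_le_mul hΓ ((hexp s).trans_eq ?_) (by positivity) ((norm_nonneg _).trans hΓ)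
      ring_nf
    · intro s hs
      rw [hnorm, Real.rpow_zero, mul_one]
      exact (mul_le_mul_of_nonneg_left (hexp s) (norm_nonneg _)).trans
        (norm_Gamma_mul_exp_le_of_re_eq_half hs)
    · intro s hs
      have hre : (s - 1).re = 1 / 2 := by simp [hs]; norm_num
      have hne : s - 1 ≠ 0 := fun h ↦ by simp [h] at hre
      have hG := Gamma_add_one (s - 1) hne
      rw [sub_add_cancel] at hG
      have h₁ := norm_Gamma_mul_exp_le_of_re_eq_half hre
      have h₂ : ‖s - 1‖ ≤ 1 + |s.im| := by
        refine (norm_le_abs_re_add_abs_im _).trans ?_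
        rw [hre]; simp; norm_num
      rw [hnorm, hG, norm_mul, Real.rpow_one]
      have him : (s - 1).im = s.im := by simp
      rw [him] at h₁
      calc ‖s - 1‖ * ‖Gamma (s - 1)‖ * Real.exp (η * (Real.pi * s.im / 2))
          ≤ (1 + |s.im|) * ‖Gamma (s - 1)‖ * Real.exp (Real.pi * |s.im| / 2) := by
            gcongr ?_ * _ * ?_; exact hexp s
        _ = (‖Gamma (s - 1)‖ * Real.exp (Real.pi * |s.im| / 2)) * (1 + |s.im|) := by ring
        _ ≤ _ := by gcongr
  obtain ⟨C₁, h₁⟩ := signed 1 (by simp)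
  obtain ⟨C₂, h₂⟩ := signed (-1) (by simp)
  refine ⟨max 0 (max C₁ C₂), le_max_left _ _, fun s hl hu ↦ ?_⟩
  have hp : 0 ≤ (1 + |s.im|) ^ (s.re - 1 / 2) := by positivity
  rcases abs_choice s.im with h | h
  · have := h₁ s hl hu
    rw [one_mul, ← h, abs_abs] at this
    exact this.trans (mul_le_mul_of_nonneg_right
      ((le_max_left _ _).trans (le_max_right _ _)) hp)
  · have := h₂ s hl hu
    rw [show -1 * (Real.pi * s.im / 2) = Real.pi * -s.im / 2 by ring, ← h] at this
    exact this.trans (mul_le_mul_of_nonneg_right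
      ((le_max_right _ _).trans (le_max_right _ _)) hp)

open Finset in
lemma exists_norm_sum_Icc_sub_le {N : ℕ} [NeZero N] (Φ : ZMod N → ℂ) :
    ∃ B : ℝ, ∀ n : ℕ, ‖∑ k ∈ Icc 1 n, Φ k - (∑ j, Φ j / N) * n‖ ≤ B := by
  set c : ℂ := ∑ j, Φ j / N with hc
  let T : ℕ → ℂ := fun n ↦ ∑ k ∈ range n, (Φ k - c)
  have hTN : T N = 0 := by
    have h : ∑ k ∈ range N, Φ k = ∑ j : ZMod N, Φ j :=
      sum_nbij' (fun k ↦ (k : ZMod N)) ZMod.val (by simp) (by simp [ZMod.val_lt])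
        (fun k hk ↦ ZMod.val_cast_of_lt (mem_range.mp hk)) (by simp) (by simp)
    have hN : (N : ℂ) ≠ 0 := NeZero.ne _
    simp only [T, sum_sub_distrib, h, sum_const, card_range, nsmul_eq_mul, hc, ← sum_div]
    field_simp
    ring
  have hT : Function.Periodic T N := by
    intro n
    induction n with
    | zero => simpa [T] using hTN
    | succ n ih =>
      have h : T (n + N + 1) = T (n + N) + (Φ ((n + N : ℕ) : ZMod N) - c) := sum_range_succ _ _
      have h' : T (n + 1) = T n + (Φ n - c) := sum_range_succ _ _
      rw [add_right_comm, h, h', ih]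
      simp
  refine ⟨∑ m ∈ range N, ‖T m‖ + ‖Φ 0 - c‖, fun n ↦ ?_⟩
  have h : ∑ k ∈ Icc 1 n, Φ k - c * n = T (n + 1) - (Φ 0 - c) := by
    induction n with
    | zero => simp [T]
    | succ n ih =>
      have h' : T (n + 1 + 1) = T (n + 1) + (Φ ((n + 1 : ℕ) : ZMod N) - c) := sum_range_succ _ _
      rw [sum_Icc_succ_top (by omega), h']
      push_cast at ih ⊢
      linear_combination ih
  rw [h]
  refine (norm_sub_le _ _).trans (add_le_add_left ?_ _)
  rw [← hT.map_mod_nat]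
  exact single_le_sum (f := fun m ↦ ‖T m‖) (fun _ _ ↦ norm_nonneg _)
    (mem_range.mpr (Nat.mod_lt _ (NeZero.pos N)))

/-- Multiplying by `s - 1` removes the pole of a `ZMod` L-function. -/
lemma exists_differentiable_eq_sub_one_mul_LFunction {N : ℕ} [NeZero N] (Φ : ZMod N → ℂ) :
    ∃ F : ℂ → ℂ, Differentiable ℂ F ∧ ∀ s ≠ 1, F s = (s - 1) * ZMod.LFunction Φ s := by
  refine ⟨Function.update (fun s ↦ (s - 1) * ZMod.LFunction Φ s) 1 (∑ j, Φ j / N), ?_,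
    fun s hs ↦ Function.update_of_ne hs ..⟩
  rw [← differentiableOn_univ,
    ← differentiableOn_compl_singleton_and_continuousAt_iff (c := 1) Filter.univ_mem]
  refine ⟨DifferentiableOn.congr (f := fun s ↦ (s - 1) * ZMod.LFunction Φ s)
    (fun s hs ↦ DifferentiableAt.differentiableWithinAt ?_)
    fun _ hs ↦ Function.update_of_ne (Set.mem_sdiff_singleton.mp hs).2 ..,
    continuousWithinAt_compl_self.mp ?_⟩
  · exact .mul (by fun_prop) (ZMod.differentiableAt_LFunction Φ s (.inl hs.2))
  · simpa using ZMod.LFunction_residue_one Φ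

open MeasureTheory Set in
/-- A crude polynomial bound for `ZMod` L-functions in the right half of the critical strip. -/
lemma exists_norm_sub_one_mul_LFunction_le {N : ℕ} [NeZero N] (Φ : ZMod N → ℂ) :
    ∃ C : ℝ, ∀ s : ℂ, 1 / 2 ≤ s.re → s.re ≤ 3 / 2 → s ≠ 1 →
      ‖(s - 1) * ZMod.LFunction Φ s‖ ≤ C * (1 + |s.im|) ^ 2 := by
  obtain ⟨F, hF, hFL⟩ := exists_differentiable_eq_sub_one_mul_LFunction Φ
  obtain ⟨B, hB⟩ := exists_norm_sum_Icc_sub_le Φ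
  set c : ℂ := ∑ j, Φ j / N
  let S : ℕ → ℂ := fun n ↦ ∑ k ∈ Finset.Icc 1 n, Φ k
  let E : ℝ → ℂ := fun t ↦ S ⌊t⌋₊ - c * t
  have hEm : Measurable E :=
    ((measurable_from_nat (f := S)).comp Nat.measurable_floor).sub (by fun_prop)
  set B' : ℝ := B + ‖c‖
  have hE (t : ℝ) (ht : 1 < t) : ‖E t‖ ≤ B' := by
    have h : E t = (S ⌊t⌋₊ - c * ⌊t⌋₊) - c * ((t - ⌊t⌋₊ : ℝ) : ℂ) := by
      simp only [E]; push_cast; ring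
    rw [h]
    refine (norm_sub_le _ _).trans (add_le_add (hB _) ?_)
    rw [norm_mul, norm_real, Real.norm_eq_abs]
    refine mul_le_of_le_one_right (norm_nonneg _) (abs_le.mpr ⟨?_, ?_⟩)
    · linarith [Nat.floor_le (by linarith : 0 ≤ t)]
    · linarith [Nat.lt_floor_add_one t]
  have hB'0 : 0 ≤ B' := (norm_nonneg _).trans (hE 2 (by norm_num))
  let G : ℝ → ℂ := (Ioi 1).indicator E
  have hGm : Measurable G := hEm.indicator measurableSet_Ioi
  have hGle (t : ℝ) : ‖G t‖ ≤ B' := by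
    by_cases ht : t ∈ Ioi 1
    · simpa [G, ht] using hE t ht
    · simpa [G, ht] using hB'0
  let M : ℂ → ℂ := fun s ↦ mellin G (-s)
  have hM (s : ℂ) : M s = ∫ t in Ioi (1 : ℝ), E t * (t : ℂ) ^ (-(s + 1)) := by
    have h (t : ℝ) : (t : ℂ) ^ (-s - 1) • G t
        = (Ioi (1 : ℝ)).indicator (fun t ↦ E t * (t : ℂ) ^ (-(s + 1))) t := by
      by_cases ht : t ∈ Ioi 1
      · simp only [G, indicator_of_mem ht, smul_eq_mul]
        rw [mul_comm]; congr 2; ring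
      · simp [G, ht]
    simp only [M, mellin, h]
    rw [setIntegral_indicator measurableSet_Ioi, inter_eq_right.mpr
      (Ioi_subset_Ioi zero_le_one)]
  have hMd (s : ℂ) (hs : 0 < s.re) : DifferentiableAt ℂ M s := by
    refine DifferentiableAt.fun_comp' s (f := fun s ↦ -s) (g := mellin G) ?_ (by fun_prop)
    refine mellin_differentiableAt_of_isBigO_rpow (a := 0) (b := -s.re - 1) ?_ ?_ (by simpa) ?_
      (by simp)
    · exact (locallyIntegrable_const B').locallyIntegrableOn _ |>.mono
        hGm.aestronglyMeasurable (by
          filter_upwards with t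
          simpa [abs_of_nonneg hB'0] using hGle t)
    · refine IsBigO.of_bound B' (Eventually.of_forall fun t ↦ ?_)
      simpa using hGle t
    · refine (EventuallyEq.trans_isBigO ?_ (isBigO_zero _ _))
      filter_upwards [Ioo_mem_nhdsGT (zero_lt_one' ℝ)] with t ht
      simp [G, ht.2.le]
  have hMint (s : ℂ) (hs : 0 < s.re) :
      IntegrableOn (fun t : ℝ ↦ E t * (t : ℂ) ^ (-(s + 1))) (Ioi 1) := by
    refine Integrable.bdd_mul (c := B') (integrableOn_Ioi_cpow_of_lt (by simpa) one_pos)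
      hEm.aestronglyMeasurable ?_
    filter_upwards [ae_restrict_mem measurableSet_Ioi] with t ht using hE t ht
  have hMle : ∃ A : ℝ, ∀ s : ℂ, 1 / 2 ≤ s.re → ‖M s‖ ≤ A := by
    refine ⟨∫ t in Ioi (1 : ℝ), B' * t ^ (-(3 / 2) : ℝ), fun s hs ↦ ?_⟩
    rw [hM]
    refine norm_integral_le_of_norm_le
      ((integrableOn_Ioi_rpow_of_lt (by norm_num) one_pos).const_mul _) ?_
    filter_upwards [ae_restrict_mem measurableSet_Ioi] with t ht
    have ht' : (1 : ℝ) < t := ht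
    rw [norm_mul, norm_cpow_eq_rpow_re_of_pos (one_pos.trans ht')]
    gcongr
    · exact hE t ht
    · exact ht'.le
    · simp; linarith
  obtain ⟨A, hA⟩ := hMle
  have hrep (s : ℂ) (hs : 1 < s.re) : F s = s * c + s * (s - 1) * M s := by
    have hs1 : s ≠ 1 := fun h ↦ by simp [h] at hs
    have hs1' : s - 1 ≠ 0 := sub_ne_zero.mpr hs1
    have hO : (fun n ↦ ∑ k ∈ Finset.Icc 1 n, Φ (k : ℕ)) =O[atTop] fun n ↦ (n : ℝ) ^ (1 : ℝ) := by
      refine IsBigO.of_bound (B + ‖c‖) ?_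
      filter_upwards [eventually_ge_atTop 1] with n hn
      have hn' : (1 : ℝ) ≤ n := by exact_mod_cast hn
      have hB0 : 0 ≤ B := (norm_nonneg _).trans (hB 0)
      have h := norm_add_le (∑ k ∈ Finset.Icc 1 n, Φ k - c * n) (c * n)
      rw [sub_add_cancel] at h
      rw [Real.rpow_one, Real.norm_natCast]
      refine h.trans ?_
      rw [norm_mul, Complex.norm_natCast, add_mul]
      exact add_le_add ((hB n).trans (le_mul_of_one_le_right hB0 hn')) le_rfl
    have hcint : IntegrableOn (fun t : ℝ ↦ c * (t : ℂ) ^ (-s)) (Ioi 1) :=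
      (integrableOn_Ioi_cpow_of_lt (by simpa) one_pos).const_mul c
    rw [hFL s hs1, ZMod.LFunction_eq_LSeries Φ hs, LSeries_eq_mul_integral _ zero_le_one hs
      (ZMod.LSeriesSummable_of_one_lt_re Φ hs) hO]
    have h : ∫ t in Ioi (1 : ℝ), (∑ k ∈ Finset.Icc 1 ⌊t⌋₊, Φ k) * (t : ℂ) ^ (-(s + 1))
        = c / (s - 1) + M s := by
      calc _ = ∫ t in Ioi (1 : ℝ), (c * (t : ℂ) ^ (-s) + E t * (t : ℂ) ^ (-(s + 1))) := by
            refine setIntegral_congr_fun measurableSet_Ioi fun t ht ↦ ?_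
            have ht0 : (t : ℂ) ≠ 0 := by
              exact_mod_cast (one_pos.trans (show (1 : ℝ) < t from ht)).ne'
            have : (t : ℂ) ^ (-s) = t * (t : ℂ) ^ (-(s + 1)) := by
              rw [show -s = 1 + -(s + 1) by ring, cpow_add _ _ ht0, cpow_one]
            simp only [this, E, S]
            ring
        _ = _ := by
            rw [integral_add hcint (hMint s (by linarith)), ← hM, integral_const_mul,
              integral_Ioi_cpow_of_lt (by simpa) one_pos]
            congr 1
            have : -s + 1 ≠ 0 := fun h ↦ hs1' (by linear_combination -h)
            rw [ofReal_one, one_cpow]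
            field_simp
            ring
    rw [h]
    field_simp
  have hcont : EqOn F (fun s ↦ s * c + s * (s - 1) * M s) {s | 0 < s.re} := by
    have hopen : IsOpen {s : ℂ | 0 < s.re} := isOpen_lt continuous_const continuous_re
    refine AnalyticOnNhd.eqOn_of_preconnected_of_eventuallyEq (z₀ := 2)
      (hF.differentiableOn.analyticOnNhd hopen) (DifferentiableOn.analyticOnNhd ?_ hopen)
      (convex_halfSpace_re_gt 0).isPreconnected (by simp) ?_
    · intro s hs
      have := hMd s hs
      exact DifferentiableAt.differentiableWithinAt (by fun_prop)
    · filter_upwards [(isOpen_lt continuous_const continuous_re).mem_nhds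
        (show (1 : ℝ) < (2 : ℂ).re by norm_num)] with s hs using hrep s hs
  refine ⟨2 * ‖c‖ + 4 * A, fun s h₁ h₂ hs ↦ ?_⟩
  have hA0 : 0 ≤ A := (norm_nonneg _).trans (hA s h₁)
  rw [← hFL s hs, hcont (show 0 < s.re by linarith)]
  have hs₀ : ‖s‖ ≤ 2 * (1 + |s.im|) := by
    refine (norm_le_abs_re_add_abs_im s).trans ?_
    rw [abs_of_nonneg (by linarith : 0 ≤ s.re)]
    linarith [abs_nonneg s.im]
  have hs₁ : ‖s - 1‖ ≤ 2 * (1 + |s.im|) := by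
    refine (norm_le_abs_re_add_abs_im _).trans ?_
    have : |(s - 1).re| ≤ 1 := by
      rw [abs_le]; constructor <;> simp <;> linarith
    simp only [sub_im, one_im, sub_zero]
    linarith [abs_nonneg s.im]
  set T : ℝ := 1 + |s.im|
  have hT : 1 ≤ T := by simp [T]
  calc ‖s * c + s * (s - 1) * M s‖ ≤ ‖s‖ * ‖c‖ + ‖s‖ * ‖s - 1‖ * ‖M s‖ := by
        refine (norm_add_le _ _).trans_eq ?_
        simp
    _ ≤ (2 * T) * ‖c‖ + (2 * T) * (2 * T) * A := by
        gcongr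
        exact hA s h₁
    _ ≤ (2 * T ^ 2) * ‖c‖ + (2 * T) * (2 * T) * A := by
        gcongr
        exact le_self_pow₀ hT (by norm_num)
    _ = _ := by ring

lemma exists_norm_LFunction_le_of_one_lt_re {N : ℕ} [NeZero N] (Φ : ZMod N → ℂ) {x : ℝ}
    (hx : 1 < x) : ∃ C : ℝ, ∀ s : ℂ, x ≤ s.re → ‖ZMod.LFunction Φ s‖ ≤ C := by
  refine ⟨∑' n, ‖LSeries.term (Φ ·) x n‖, fun s hs ↦ ?_⟩
  rw [ZMod.LFunction_eq_LSeries Φ (hx.trans_le hs)]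
  exact tsum_of_norm_bounded
    (ZMod.LSeriesSummable_of_one_lt_re Φ (s := x) (by simpa)).norm.hasSum
    fun n ↦ LSeries.norm_term_le_of_re_le_re _ (by simpa) n

open ZMod in
/-- The functional equation with the gamma and exponential factors estimated. -/
lemma exists_norm_LFunction_le_one_sub {N : ℕ} [NeZero N] (Φ : ZMod N → ℂ) :
    ∃ C : ℝ, 0 ≤ C ∧ ∀ s : ℂ, -(1 / 2) ≤ s.re → s.re ≤ 1 / 2 → s.im ≠ 0 →
      ‖LFunction Φ s‖ ≤ C * (1 + |s.im|) ^ (1 / 2 - s.re) *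
        (‖LFunction (dft Φ) (1 - s)‖ + ‖LFunction (dft fun x ↦ Φ (-x)) (1 - s)‖) := by
  obtain ⟨C, hC0, hC⟩ := exists_norm_Gamma_mul_exp_le
  refine ⟨N * C, by positivity, fun s h₁ h₂ him ↦ ?_⟩
  obtain ⟨w, rfl⟩ : ∃ w, s = 1 - w := ⟨1 - s, by ring⟩
  have him' : w.im ≠ 0 := by simpa using him
  simp only [sub_re, one_re] at h₁ h₂
  have hΓ := hC w (by linarith) (by linarith)
  rw [LFunction_one_sub Φ (fun n h ↦ him' (by simp [h])) (.inr fun h ↦ him' (by simp [h])),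
    sub_sub_cancel]
  have hN : ‖(N : ℂ) ^ (w - 1)‖ ≤ N := by
    rw [norm_natCast_cpow_of_pos (NeZero.pos N)]
    have : (1 : ℝ) ≤ N := by exact_mod_cast NeZero.one_le
    calc (N : ℝ) ^ (w - 1).re ≤ (N : ℝ) ^ (1 : ℝ) :=
          Real.rpow_le_rpow_of_exponent_le this (by simp; linarith)
      _ = N := Real.rpow_one _
  have hpi : ‖(2 * Real.pi : ℂ) ^ (-w)‖ ≤ 1 := by
    rw [show (2 * Real.pi : ℂ) = ((2 * Real.pi : ℝ) : ℂ) by push_cast; rfl,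
      norm_cpow_eq_rpow_re_of_pos (by positivity)]
    exact Real.rpow_le_one_of_one_le_of_nonpos (by linarith [Real.pi_gt_three])
      (by simp; linarith)
  have hexp : |Real.pi * w.im / 2| = Real.pi * |w.im| / 2 := by
    rw [abs_div, abs_mul, abs_of_pos Real.pi_pos, abs_two]
  have he₁ : ‖cexp (Real.pi * I * w / 2)‖ ≤ Real.exp (Real.pi * |w.im| / 2) := by
    rw [Complex.norm_exp, ← hexp]
    gcongr
    refine le_trans (le_of_eq ?_) (neg_le_abs _)
    simp [neg_div]
  have he₂ : ‖cexp (-Real.pi * I * w / 2)‖ ≤ Real.exp (Real.pi * |w.im| / 2) := by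
    rw [Complex.norm_exp, ← hexp]
    gcongr
    refine le_trans (le_of_eq ?_) (le_abs_self _)
    simp
  have hexponent : 1 / 2 - (1 - w).re = w.re - 1 / 2 := by simp; ring
  have habs : |(1 - w).im| = |w.im| := by simp
  rw [hexponent, habs]
  set e := Real.exp (Real.pi * |w.im| / 2)
  set L₁ := LFunction (dft Φ) w
  set L₂ := LFunction (dft fun x ↦ Φ (-x)) w
  calc _ ≤ N * 1 * ‖Gamma w‖ * (e * ‖L₁‖ + e * ‖L₂‖) := by
        rw [norm_mul, norm_mul, norm_mul]
        gcongr
        refine (norm_add_le _ _).trans ?_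
        rw [norm_mul, norm_mul]
        gcongr
    _ = N * (‖Gamma w‖ * e) * (‖L₁‖ + ‖L₂‖) := by ring
    _ ≤ N * (C * (1 + |w.im|) ^ (w.re - 1 / 2)) * (‖L₁‖ + ‖L₂‖) := by gcongr
    _ = _ := by ring

lemma exists_norm_le_of_abs_im_le_one {F : ℂ → ℂ} (hF : Continuous F) (a b : ℝ) :
    ∃ B : ℝ, ∀ s : ℂ, a ≤ s.re → s.re ≤ b → |s.im| ≤ 1 → ‖F s‖ ≤ B := by
  obtain ⟨B, hB⟩ := (isCompact_Icc.reProdIm isCompact_Icc :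
    IsCompact (Set.Icc a b ×ℂ Set.Icc (-1) 1)).exists_bound_of_continuousOn hF.continuousOn
  exact ⟨B, fun s h₁ h₂ h ↦ hB s ⟨⟨h₁, h₂⟩, abs_le.mp h⟩⟩

lemma norm_sub_one_le_two_mul {s : ℂ} (h₁ : -(1 / 2) ≤ s.re) (h₂ : s.re ≤ 3 / 2) :
    ‖s - 1‖ ≤ 2 * (1 + |s.im|) := by
  refine (norm_le_abs_re_add_abs_im _).trans ?_
  have : |(s - 1).re| ≤ 2 := by
    rw [abs_le]; constructor <;> simp <;> linarith
  simp only [sub_im, one_im, sub_zero]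
  linarith [abs_nonneg s.im]

lemma exists_norm_LFunction_le_of_one_le_abs_im {N : ℕ} [NeZero N] (Φ : ZMod N → ℂ) :
    ∃ C : ℝ, ∀ s : ℂ, 1 / 2 ≤ s.re → s.re ≤ 3 / 2 → 1 ≤ |s.im| →
      ‖ZMod.LFunction Φ s‖ ≤ C * (1 + |s.im|) ^ 2 := by
  obtain ⟨C, hC⟩ := exists_norm_sub_one_mul_LFunction_le Φ
  refine ⟨C, fun s h₁ h₂ h ↦ ?_⟩
  have hs : s ≠ 1 := fun hs ↦ by norm_num [hs] at h
  have h1 : 1 ≤ ‖s - 1‖ := h.trans (by simpa using abs_im_le_norm (s - 1))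
  have := hC s h₁ h₂ hs
  rw [norm_mul] at this
  exact (le_mul_of_one_le_left (norm_nonneg _) h1).trans this

/-- A crude growth bound for `ZMod` L-functions in a strip containing the critical strip. -/
lemma exists_norm_le_mul_exp_of_eq_sub_one_mul_LFunction {N : ℕ} [NeZero N] {Φ : ZMod N → ℂ}
    {F : ℂ → ℂ} (hF : Continuous F) (hFL : ∀ s ≠ 1, F s = (s - 1) * ZMod.LFunction Φ s) :
    ∃ K : ℝ, ∀ s : ℂ, -(1 / 2) ≤ s.re → s.re ≤ 3 / 2 → ‖F s‖ ≤ K * Real.exp (4 * |s.im|) := by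
  obtain ⟨B, hB⟩ := exists_norm_le_of_abs_im_le_one hF (-(1 / 2)) (3 / 2)
  obtain ⟨C₀, h₀⟩ := exists_norm_LFunction_le_of_one_le_abs_im Φ
  obtain ⟨C₁, h₁⟩ := exists_norm_LFunction_le_of_one_le_abs_im (ZMod.dft Φ)
  obtain ⟨C₂, h₂⟩ := exists_norm_LFunction_le_of_one_le_abs_im (ZMod.dft fun x ↦ Φ (-x))
  obtain ⟨C, hC0, hC⟩ := exists_norm_LFunction_le_one_sub Φ
  refine ⟨max B (2 * max C₀ (C * (C₁ + C₂))), fun s hl hu ↦ ?_⟩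
  set K := max B (2 * max C₀ (C * (C₁ + C₂)))
  rcases le_total |s.im| 1 with him | him
  · have hBs := hB s hl hu him
    have hK : B ≤ K := le_max_left _ _
    exact hBs.trans (hK.trans (le_mul_of_one_le_right
      ((norm_nonneg _).trans (hBs.trans hK)) (Real.one_le_exp (by positivity))))
  have hs : s ≠ 1 := fun hs ↦ by norm_num [hs] at him
  set T := 1 + |s.im|
  have hT : 1 ≤ T := by simp [T]
  have hL : ‖ZMod.LFunction Φ s‖ ≤ max C₀ (C * (C₁ + C₂)) * T ^ 3 := by
    rcases le_total (1 / 2) s.re with h | h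
    · have hb := h₀ s h hu him
      have hC₀ : 0 ≤ C₀ := nonneg_of_mul_nonneg_left ((norm_nonneg _).trans hb) (by positivity)
      refine hb.trans (mul_le_mul (le_max_left _ _) ?_ (by positivity)
        (hC₀.trans (le_max_left _ _)))
      exact pow_le_pow_right₀ hT (by norm_num)
    · have hre₁ : 1 / 2 ≤ (1 - s).re := by simp; linarith
      have hre₂ : (1 - s).re ≤ 3 / 2 := by simp; linarith
      have him' : |(1 - s).im| = |s.im| := by simp
      have hb₁ := h₁ (1 - s) hre₁ hre₂ (by rwa [him'])
      have hb₂ := h₂ (1 - s) hre₁ hre₂ (by rwa [him'])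
      rw [him'] at hb₁ hb₂
      have hC₁₂ : 0 ≤ C₁ + C₂ := by
        refine add_nonneg ?_ ?_
        · exact nonneg_of_mul_nonneg_left ((norm_nonneg _).trans hb₁) (by positivity)
        · exact nonneg_of_mul_nonneg_left ((norm_nonneg _).trans hb₂) (by positivity)
      have hexp : T ^ (1 / 2 - s.re) ≤ T := by
        simpa using Real.rpow_le_rpow_of_exponent_le hT (by linarith : 1 / 2 - s.re ≤ 1)
      calc _ ≤ C * T ^ (1 / 2 - s.re) * (‖ZMod.LFunction (ZMod.dft Φ) (1 - s)‖ +
              ‖ZMod.LFunction (ZMod.dft fun x ↦ Φ (-x)) (1 - s)‖) :=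
            hC s hl h (abs_pos.mp (one_pos.trans_le him))
        _ ≤ C * T * (C₁ * T ^ 2 + C₂ * T ^ 2) := by gcongr
        _ = C * (C₁ + C₂) * T ^ 3 := by ring
        _ ≤ _ := by gcongr; exact le_max_right _ _
  have hm0 : 0 ≤ max C₀ (C * (C₁ + C₂)) :=
    nonneg_of_mul_nonneg_left ((norm_nonneg _).trans hL) (by positivity)
  have hexp : T ^ 4 ≤ Real.exp (4 * |s.im|) := by
    have : Real.exp (4 * |s.im|) = Real.exp |s.im| ^ 4 := by
      rw [← Real.exp_nat_mul]; norm_num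
    rw [this]
    gcongr
    linarith [Real.add_one_le_exp |s.im|]
  rw [hFL s hs, norm_mul]
  calc _ ≤ (2 * T) * (max C₀ (C * (C₁ + C₂)) * T ^ 3) := by
        gcongr
        exact norm_sub_one_le_two_mul hl hu
    _ = 2 * max C₀ (C * (C₁ + C₂)) * T ^ 4 := by ring
    _ ≤ K * Real.exp (4 * |s.im|) := by
        gcongr
        exact le_max_right _ _

/-- The convexity bound for `ZMod` L-functions, with the pole removed, in the strip
`-δ ≤ re s ≤ 1 + δ`. -/
lemma exists_norm_le_one_add_abs_im_rpow_of_eq_sub_one_mul_LFunction {N : ℕ} [NeZero N]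
    {Φ : ZMod N → ℂ} {F : ℂ → ℂ} (hF : Differentiable ℂ F)
    (hFL : ∀ s ≠ 1, F s = (s - 1) * ZMod.LFunction Φ s) {δ : ℝ} (hδ : 0 < δ) (hδ' : δ ≤ 1 / 2) :
    ∃ C : ℝ, ∀ s : ℂ, -δ ≤ s.re → s.re ≤ 1 + δ →
      ‖F s‖ ≤ C * (1 + |s.im|) ^ ((1 + δ - s.re) / 2 + 1) := by
  obtain ⟨K, hK⟩ := exists_norm_le_mul_exp_of_eq_sub_one_mul_LFunction hF.continuous hFL
  obtain ⟨B, hB⟩ := exists_norm_le_of_abs_im_le_one hF.continuous (-δ) (1 + δ)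
  have hδ1 : 1 < 1 + δ := by linarith
  obtain ⟨C₀, h₀⟩ := exists_norm_LFunction_le_of_one_lt_re Φ hδ1
  obtain ⟨C₁, h₁⟩ := exists_norm_LFunction_le_of_one_lt_re (ZMod.dft Φ) hδ1
  obtain ⟨C₂, h₂⟩ := exists_norm_LFunction_le_of_one_lt_re (ZMod.dft fun x ↦ Φ (-x)) hδ1
  obtain ⟨C, hC0, hC⟩ := exists_norm_LFunction_le_one_sub Φ
  refine (exists_norm_le_one_add_abs_im_rpow_of_strip (f := F) (l := -δ) (u := 1 + δ)
    (α := 3 / 2 + δ) (β := 1) (A := max B (2 * (C * (C₁ + C₂)))) (B := 2 * C₀) (K := K) (k := 4)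
    (by linarith) (by linarith) zero_le_one (by norm_num) hF.diffContOnCl
    (fun s hl hu ↦ hK s (by linarith) (by linarith)) (fun s hs ↦ ?_) (fun s hs ↦ ?_)).imp
    fun C hC s hl hu ↦ ?_
  · rcases le_total |s.im| 1 with him | him
    · have hBs := hB s hs.ge (by linarith) him
      have hA : B ≤ max B (2 * (C * (C₁ + C₂))) := le_max_left _ _
      exact hBs.trans (hA.trans (le_mul_of_one_le_right ((norm_nonneg _).trans (hBs.trans hA))
        (Real.one_le_rpow (by simp) (by linarith))))
    have hs1 : s ≠ 1 := fun h ↦ by norm_num [h] at him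
    have hre : 1 + δ ≤ (1 - s).re := by simp [hs]
    have hb₁ := h₁ (1 - s) hre
    have hb₂ := h₂ (1 - s) hre
    have hT : 0 < 1 + |s.im| := by positivity
    rw [hFL s hs1, norm_mul]
    calc _ ≤ (2 * (1 + |s.im|)) * (C * (1 + |s.im|) ^ (1 / 2 - s.re) * (C₁ + C₂)) := by
          gcongr
          · exact norm_sub_one_le_two_mul (by linarith) (by linarith)
          · refine (hC s (by linarith) (by linarith)
              (abs_pos.mp (one_pos.trans_le him))).trans ?_
            gcongr
      _ = 2 * (C * (C₁ + C₂)) * ((1 + |s.im|) ^ (1 : ℝ) * (1 + |s.im|) ^ (1 / 2 - s.re)) := by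
          rw [Real.rpow_one]; ring
      _ = 2 * (C * (C₁ + C₂)) * (1 + |s.im|) ^ (3 / 2 + δ) := by
          rw [← Real.rpow_add hT, hs]; ring_nf
      _ ≤ _ := by gcongr; exact le_max_right _ _
  · have hs1 : s ≠ 1 := fun h ↦ by
      rw [h, one_re] at hs
      linarith
    rw [hFL s hs1, norm_mul, Real.rpow_one]
    calc _ ≤ (2 * (1 + |s.im|)) * C₀ := by
          gcongr
          · exact norm_sub_one_le_two_mul (by linarith) (by linarith)
          · exact h₀ s hs.ge
      _ = _ := by ring
  · convert hC s hl hu using 3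
    have : 1 + δ - -δ ≠ 0 := by linarith
    field_simp
    ring

/-- For a Dirichlet character `χ` and fixed `ε > 0`,
`L(σ + it, χ) ≪_{χ,ε} 1 + |t| ^ ((1-σ)/2 + ε)`, uniformly for `σ ≥ 1/2`, `|t| ≥ 1`. -/
theorem dirichlet_LFunction_convexity_bound
    (q : ℕ) [NeZero q] (χ : DirichletCharacter ℂ q) (ε : ℝ) (hε : 0 < ε) :
    ∃ C : ℝ, ∀ σ t : ℝ, 1 / 2 ≤ σ → 1 ≤ |t| →
      ‖DirichletCharacter.LFunction χ (σ + t * Complex.I)‖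
        ≤ C * (1 + |t| ^ ((1 - σ) / 2 + ε)) := by
  set δ : ℝ := min ε (1 / 2)
  have hδ : 0 < δ := lt_min hε (by norm_num)
  have hδε : δ ≤ ε := min_le_left _ _
  obtain ⟨F, hF, hFL⟩ := exists_differentiable_eq_sub_one_mul_LFunction (χ ·)
  obtain ⟨C₀, h₀⟩ := exists_norm_LFunction_le_of_one_lt_re (χ ·) (x := 1 + δ) (by linarith)
  obtain ⟨C, hC⟩ := exists_norm_le_one_add_abs_im_rpow_of_eq_sub_one_mul_LFunction hF hFL hδ
    (min_le_right _ _)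
  refine ⟨max C₀ (4 * C), fun σ t hσ ht ↦ ?_⟩
  set s : ℂ := σ + t * I
  have hre : s.re = σ := by simp [s]
  have him : s.im = t := by simp [s]
  have ht0 : 0 < |t| := one_pos.trans_le ht
  change ‖ZMod.LFunction (χ ·) s‖ ≤ _
  rcases le_total (1 + δ) σ with h | h
  · have hb := h₀ s (by rwa [hre])
    have hm : C₀ ≤ max C₀ (4 * C) := le_max_left _ _
    refine hb.trans (hm.trans (le_mul_of_one_le_right ((norm_nonneg _).trans (hb.trans hm)) ?_))
    simp only [le_add_iff_nonneg_right]
    positivity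
  · have hs1 : s ≠ 1 := fun h ↦ by
      rw [h, one_im] at him
      norm_num [← him] at ht
    have hb := hC s (by linarith) (by linarith)
    have hC0 : 0 ≤ C := nonneg_of_mul_nonneg_left ((norm_nonneg _).trans hb) (by positivity)
    rw [hFL s hs1, norm_mul, hre, him] at hb
    have hts : |t| ≤ ‖s - 1‖ := by simpa [him] using abs_im_le_norm (s - 1)
    set e : ℝ := (1 + δ - σ) / 2 with he
    have he0 : 0 ≤ e := by linarith
    have hmain : |t| * ‖ZMod.LFunction (χ ·) s‖ ≤ |t| * (4 * C * |t| ^ e) := by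
      calc _ ≤ ‖s - 1‖ * ‖ZMod.LFunction (χ ·) s‖ := by gcongr
        _ ≤ C * (1 + |t|) ^ (e + 1) := hb
        _ ≤ C * (2 * |t|) ^ (e + 1) := by gcongr; linarith
        _ = C * (2 ^ (e + 1) * (|t| ^ e * |t|)) := by
            rw [Real.mul_rpow zero_le_two ht0.le, Real.rpow_add_one ht0.ne']
        _ ≤ C * (2 ^ (2 : ℝ) * (|t| ^ e * |t|)) := by
            gcongr
            · norm_num
            · have : δ ≤ 1 / 2 := min_le_right _ _
              linarith
        _ = _ := by norm_num; ring
    calc _ ≤ 4 * C * |t| ^ e := le_of_mul_le_mul_left hmain ht0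
      _ ≤ max C₀ (4 * C) * (1 + |t| ^ ((1 - σ) / 2 + ε)) := by
          gcongr
          · exact le_max_right _ _
          · refine (Real.rpow_le_rpow_of_exponent_le ht ?_).trans (le_add_of_nonneg_left zero_le_one)
            linarith
end
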